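/- arXiv:2007.08831 — 6 statements merged into one kernel-verified Lean document; each statement's English description precedes it below -/
import Mathlib

section
/- Let p, q ∈ D be such that deg p and deg q are odd integers. If p has a unique real root or q has a unique real root, then the matrix [[p, q], [0, 0]] ∈ M₂(D) is a product of idempotent matrices over D. -/
/-- The minimal Dress ring of `ℝ(X)`: the smallest subring of `RatFunc ℝ` containing
every element of the form `1/(1+x²)`. -/
noncomputable def DressD : Subring (RatFunc ℝ) :=
  Subring.closure {z : RatFunc ℝ | ∃ x : RatFunc ℝ, z = (1 + x ^ 2)⁻¹}

/-- Evaluation at a real number of an element of the Dress ring. -/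
noncomputable def evalD (p : DressD) (u : ℝ) : ℝ :=
  RatFunc.eval (RingHom.id ℝ) u (p : RatFunc ℝ)

/-- A `2 × 2` matrix is a product of idempotent matrices if it is the product of a
finite list of idempotent matrices. -/
def IsProductOfIdempotents {R : Type*} [CommRing R] (A : Matrix (Fin 2) (Fin 2) R) : Prop :=
  ∃ L : List (Matrix (Fin 2) (Fin 2) R), (∀ T ∈ L, IsIdempotentElem T) ∧ L.prod = A


section Idempotents

variable {R : Type*} [CommRing R]

theorem IsProductOfIdempotents.mul {A B : Matrix (Fin 2) (Fin 2) R}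
    (hA : IsProductOfIdempotents A) (hB : IsProductOfIdempotents B) :
    IsProductOfIdempotents (A * B) := by
  obtain ⟨L, hL, rfl⟩ := hA
  obtain ⟨M, hM, rfl⟩ := hB
  refine ⟨L ++ M, fun T hT => ?_, List.prod_append⟩
  rcases List.mem_append.1 hT with h | h
  exacts [hL T h, hM T h]

theorem IsIdempotentElem.isProductOfIdempotents {T : Matrix (Fin 2) (Fin 2) R}
    (hT : IsIdempotentElem T) : IsProductOfIdempotents T :=
  ⟨[T], by simpa using hT, by simp⟩

theorem IsProductOfIdempotents.conj {A U V : Matrix (Fin 2) (Fin 2) R}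
    (hA : IsProductOfIdempotents A) (hUV : U * V = 1) (hVU : V * U = 1) :
    IsProductOfIdempotents (V * A * U) := by
  obtain ⟨L, hL, rfl⟩ := hA
  induction L with
  | nil => exact ⟨[], by simp, by simp [hVU]⟩
  | cons T L ih =>
    have h : V * (T :: L).prod * U = (V * T * U) * (V * L.prod * U) := by
      rw [List.prod_cons]
      calc V * (T * L.prod) * U = V * T * 1 * L.prod * U := by noncomm_ring
        _ = (V * T * U) * (V * L.prod * U) := by rw [← hUV]; noncomm_ring
    rw [h]
    refine .mul (IsIdempotentElem.isProductOfIdempotents ?_)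
      (ih fun S hS => hL S (List.mem_cons_of_mem _ hS))
    have hT : T * T = T := hL T List.mem_cons_self
    calc V * T * U * (V * T * U) = V * T * (U * V) * T * U := by noncomm_ring
      _ = V * (T * T) * U := by rw [hUV]; noncomm_ring
      _ = V * T * U := by rw [hT]

/-- The row `(x, y)`, completed by a zero row, is a product of idempotent matrices. -/
def IsIdempotentRow (x y : R) : Prop :=
  IsProductOfIdempotents !![x, y; 0, 0]

theorem isIdempotentElem_fin_two {a b c d : R} (h₁ : a * a + b * c = a)
    (h₂ : a * b + b * d = b) (h₃ : c * a + d * c = c) (h₄ : c * b + d * d = d) :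
    IsIdempotentElem !![a, b; c, d] := by
  rw [IsIdempotentElem, Matrix.mul_fin_two, h₁, h₂, h₃, h₄]

namespace IsIdempotentRow

theorem mul_idempotent {x y a b c d : R} (h : IsIdempotentRow x y)
    (hT : IsIdempotentElem !![a, b; c, d]) :
    IsIdempotentRow (x * a + y * c) (x * b + y * d) := by
  have := IsProductOfIdempotents.mul h hT.isProductOfIdempotents
  simpa only [IsIdempotentRow, Matrix.mul_fin_two, mul_zero, zero_mul, add_zero, zero_add] using this

theorem single (x : R) : IsIdempotentRow x 0 := by
  have h1 : IsIdempotentRow (1 : R) 0 :=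
    (isIdempotentElem_fin_two (by simp) (by simp) (by simp) (by simp)).isProductOfIdempotents
  have h2 := h1.mul_idempotent (a := 1) (b := 1) (c := 0) (d := 0)
    (isIdempotentElem_fin_two (by simp) (by simp) (by simp) (by simp))
  have h3 := h2.mul_idempotent (a := 0) (b := 0) (c := x) (d := 1)
    (isIdempotentElem_fin_two (by simp) (by simp) (by simp) (by simp))
  have h4 := h3.mul_idempotent (a := 1) (b := 0) (c := 0) (d := 0)
    (isIdempotentElem_fin_two (by simp) (by simp) (by simp) (by simp))
  simpa using h4

theorem smul {x y : R} (h : IsIdempotentRow x y) (c : R) :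
    IsIdempotentRow (c * x) (c * y) := by
  have := IsProductOfIdempotents.mul (single c) h
  simpa only [IsIdempotentRow, Matrix.mul_fin_two, mul_zero, zero_mul, add_zero, zero_add] using this

theorem add_right {x y : R} (h : IsIdempotentRow x y) (t : R) :
    IsIdempotentRow x (y + t * x) := by
  have := IsProductOfIdempotents.conj h (U := !![1, t; 0, 1]) (V := !![1, -t; 0, 1])
    (by simp [Matrix.one_fin_two])
    (by simp [Matrix.one_fin_two])
  simpa only [IsIdempotentRow, Matrix.mul_fin_two, mul_zero, zero_mul, add_zero, zero_add,
    one_mul, mul_one, mul_comm x t, add_comm _ y] using this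

theorem swap {x y : R} (h : IsIdempotentRow x y) : IsIdempotentRow y x := by
  have h1 := IsProductOfIdempotents.conj h (U := !![0, 1; 1, 0]) (V := !![0, 1; 1, 0])
    (by simp [Matrix.one_fin_two])
    (by simp [Matrix.one_fin_two])
  have h2 : IsIdempotentElem (!![1, 1; 0, 0] : Matrix (Fin 2) (Fin 2) R) :=
    isIdempotentElem_fin_two (by simp) (by simp) (by simp) (by simp)
  simpa only [IsIdempotentRow, Matrix.mul_fin_two, mul_zero, zero_mul, add_zero, zero_add,
    one_mul, mul_one] using h2.isProductOfIdempotents.mul h1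

theorem add_left {x y : R} (h : IsIdempotentRow x y) (t : R) :
    IsIdempotentRow (x + t * y) y :=
  (h.swap.add_right t).swap

end IsIdempotentRow

end Idempotents

open Polynomial

/-- A nonconstant real polynomial without real roots has a monic quadratic factor
`(X - a)² + b²` with `b ≠ 0`. -/
theorem exists_quadratic_factor {γ : ℝ[X]} (hγ : ∀ u, γ.eval u ≠ 0) (hd : γ.natDegree ≠ 0) :
    ∃ (a b : ℝ) (δ : ℝ[X]), b ≠ 0 ∧ γ = ((X - C a) ^ 2 + C (b ^ 2)) * δ := by
  obtain ⟨z, hz⟩ := IsAlgClosed.exists_aeval_eq_zero ℂ γ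
    (fun h => hd (natDegree_eq_of_degree_eq_some h))
  have him : z.im ≠ 0 := by
    intro him
    have h : z = algebraMap ℝ ℂ z.re := Complex.ext (by simp) (by simpa using him)
    rw [h, aeval_algebraMap_apply] at hz
    exact hγ z.re (by simpa [Polynomial.coe_aeval_eq_eval] using hz)
  obtain ⟨δ, hδ⟩ := γ.quadratic_dvd_of_aeval_eq_zero_im_ne_zero hz him
  refine ⟨z.re, z.im, δ, him, ?_⟩
  rw [hδ]
  congr 1
  have : ‖z‖ ^ 2 = z.re ^ 2 + z.im ^ 2 := by
    rw [← Complex.normSq_eq_norm_sq, Complex.normSq_apply]; ring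
  rw [this]
  simp only [map_add, map_mul, map_pow, map_ofNat]
  ring

theorem natDegree_sq_add_C (a c : ℝ) : ((X - C a) ^ 2 + C c : ℝ[X]).natDegree = 2 := by
  rw [natDegree_add_C, natDegree_pow, natDegree_X_sub_C]

theorem leadingCoeff_sq_add_C (a c : ℝ) : ((X - C a) ^ 2 + C c : ℝ[X]).leadingCoeff = 1 := by
  rw [leadingCoeff_add_of_degree_lt']
  · simp
  · refine lt_of_le_of_lt degree_C_le ?_
    simp

theorem even_natDegree_and_pos {γ : ℝ[X]} (hγ : ∀ u, γ.eval u ≠ 0) :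
    Even γ.natDegree ∧ ∀ u, 0 < γ.eval u * γ.leadingCoeff := by
  induction h : γ.natDegree using Nat.strong_induction_on generalizing γ with
  | _ n ih =>
    by_cases hn : n = 0
    · obtain ⟨c, rfl⟩ := natDegree_eq_zero.1 (h.trans hn)
      have hc : c ≠ 0 := by simpa using hγ 0
      exact ⟨by simp [hn], fun u => by simpa using hc⟩
    · obtain ⟨a, b, δ, hb, rfl⟩ := exists_quadratic_factor hγ (h ▸ hn)
      have hδ : ∀ u, δ.eval u ≠ 0 := fun u hu => hγ u (by simp [hu])
      have hδ0 : δ ≠ 0 := by rintro rfl; exact hδ 0 (by simp)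
      have hQ0 : ((X - C a) ^ 2 + C (b ^ 2) : ℝ[X]) ≠ 0 :=
        ne_zero_of_natDegree_gt (n := 1) (by rw [natDegree_sq_add_C]; norm_num)
      rw [natDegree_mul hQ0 hδ0, natDegree_sq_add_C] at h
      obtain ⟨h1, h2⟩ := ih _ (by omega) hδ rfl
      refine ⟨by rw [← h]; exact even_two.add h1, fun u => ?_⟩
      rw [leadingCoeff_mul, leadingCoeff_sq_add_C, one_mul, eval_mul, mul_assoc]
      refine mul_pos ?_ (h2 u)
      simp only [eval_add, eval_pow, eval_sub, eval_X, eval_C]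
      positivity

local notation "ι" => algebraMap ℝ[X] (RatFunc ℝ)

theorem inv_one_add_sq_mem_dressD (x : RatFunc ℝ) : (1 + x ^ 2)⁻¹ ∈ DressD :=
  Subring.subset_closure ⟨x, rfl⟩

theorem C_mem_dressD (r : ℝ) : ι (C r) ∈ DressD := by
  have h01 : ∀ s : ℝ, 0 < s → s ≤ 1 → ι (C s) ∈ DressD := by
    intro s h0 h1
    have h := inv_one_add_sq_mem_dressD (ι (C (√(s⁻¹ - 1))))
    have e : (1 + ι (C (√(s⁻¹ - 1))) ^ 2)⁻¹ = ι (C s) := by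
      rw [← map_pow, ← map_pow, Real.sq_sqrt (by simpa using (one_le_inv₀ h0).2 h1)]
      refine inv_eq_of_mul_eq_one_left ?_
      rw [← map_one ι, ← map_add, ← map_mul, ← C_1, ← C_add, ← C_mul, add_sub_cancel,
        mul_inv_cancel₀ h0.ne']
    rwa [e] at h
  have hpos : ∀ s : ℝ, 0 < s → ι (C s) ∈ DressD := by
    intro s h0
    obtain ⟨n, hn⟩ := exists_nat_gt s
    have hn0 : (0 : ℝ) < n := h0.trans hn
    have := mul_mem (natCast_mem DressD n) (h01 (s / n) (by positivity) ((div_le_one hn0).2 hn.le))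
    have e : (n : RatFunc ℝ) * ι (C (s / n)) = ι (C s) := by
      rw [← map_natCast ι n, ← map_natCast C n, ← map_mul, ← map_mul, mul_div_cancel₀ _ hn0.ne']
    rwa [e] at this
  rcases lt_trichotomy r 0 with h | rfl | h
  · have := neg_mem (hpos (-r) (by linarith))
    simpa using this
  · simp
  · exact hpos r h

theorem div_one_add_sq_mem_dressD {y : RatFunc ℝ} (hy : 1 + y ^ 2 ≠ 0) :
    y / (1 + y ^ 2) ∈ DressD := by
  by_cases h1 : y = 1
  · subst h1
    simpa using inv_one_add_sq_mem_dressD 1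
  have h1' : 1 - y ≠ 0 := sub_ne_zero.2 (Ne.symm h1)
  have h2 : (2 : RatFunc ℝ) ≠ 0 := two_ne_zero
  have key : y / (1 + y ^ 2) = (1 + 1 ^ 2)⁻¹ - (1 + ((1 + y) / (1 - y)) ^ 2)⁻¹ := by
    have h3 : 1 + ((1 + y) / (1 - y)) ^ 2 = 2 * (1 + y ^ 2) / (1 - y) ^ 2 := by
      field_simp; ring
    have h4 : (1 + 1 ^ 2 : RatFunc ℝ) = 2 := by norm_num
    rw [h3, h4, inv_div]
    field_simp
    ring
  rw [key]
  exact sub_mem (inv_one_add_sq_mem_dressD _) (inv_one_add_sq_mem_dressD _)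

theorem div_mem_dressD {f γ : ℝ[X]} (hγ : ∀ u, γ.eval u ≠ 0)
    (hd : f.natDegree ≤ γ.natDegree) : ι f / ι γ ∈ DressD := by
  induction h : γ.natDegree using Nat.strong_induction_on generalizing f γ with
  | _ n ih =>
    by_cases hn : n = 0
    · obtain ⟨c, rfl⟩ := natDegree_eq_zero.1 (h.trans hn)
      obtain ⟨d, rfl⟩ := natDegree_eq_zero.1 (by simpa using hd)
      have hc : c ≠ 0 := by simpa using hγ 0
      have hc' : ι (C c) ≠ 0 := by simpa using hc
      have e : ι (C d) / ι (C c) = ι (C (d / c)) := by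
        rw [div_eq_iff hc', ← map_mul, ← C_mul, div_mul_cancel₀ _ hc]
      rw [e]
      exact C_mem_dressD _
    · obtain ⟨a, b, δ, hb, rfl⟩ := exists_quadratic_factor hγ (h ▸ hn)
      have hδ : ∀ u, δ.eval u ≠ 0 := fun u hu => hγ u (by simp [hu])
      have hδ0 : δ ≠ 0 := by rintro rfl; exact hδ 0 (by simp)
      have hQm : ((X - C a) ^ 2 + C (b ^ 2) : ℝ[X]).Monic := leadingCoeff_sq_add_C _ _
      have hQd := natDegree_sq_add_C a (b ^ 2)
      have hQe : ι ((X - C a) ^ 2 + C (b ^ 2)) = ι (X - C a) ^ 2 + ι (C b) ^ 2 := by simp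
      set Q : ℝ[X] := (X - C a) ^ 2 + C (b ^ 2) with hQ
      rw [natDegree_mul hQm.ne_zero hδ0, hQd] at h hd
      have hQ0 : ι Q ≠ 0 := by simpa using hQm.ne_zero
      have hδ0' : ι δ ≠ 0 := by simpa using hδ0
      have hb' : ι (C b) ≠ 0 := by simpa using hb
      have hr : (f %ₘ Q).natDegree ≤ 1 := by
        have := natDegree_modByMonic_lt f hQm (fun h1 => by rw [h1] at hQd; simp at hQd)
        omega
      obtain ⟨s, t, hst⟩ := exists_eq_X_add_C_of_natDegree_le_one hr
      have hf : f = (C s * (X - C a) + C (s * a + t)) + Q * (f /ₘ Q) := by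
        conv_lhs => rw [← modByMonic_add_div f Q, hst]
        simp only [C_add, C_mul]
        ring
      have hden : 1 + (ι (X - C a) / ι (C b)) ^ 2 = ι Q / ι (C b) ^ 2 := by
        rw [hQe]; field_simp; ring
      have m1 : (ι Q)⁻¹ ∈ DressD := by
        have h1 := inv_one_add_sq_mem_dressD (ι (X - C a) / ι (C b))
        have h2 := mul_mem (C_mem_dressD (b⁻¹ ^ 2)) h1
        have hbb : ι (C (b⁻¹ ^ 2)) * ι (C b) ^ 2 = 1 := by
          rw [← map_pow, ← map_mul, ← C_pow, ← C_mul, ← mul_pow, inv_mul_cancel₀ hb]; simp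
        rwa [hden, inv_div, ← mul_div_assoc, hbb, one_div] at h2
      have m2 : ι (X - C a) / ι Q ∈ DressD := by
        have h1 := div_one_add_sq_mem_dressD (y := ι (X - C a) / ι (C b))
          (by rw [hden]; exact div_ne_zero hQ0 (pow_ne_zero _ hb'))
        have h2 := mul_mem (C_mem_dressD b⁻¹) h1
        have hbb : ι (C b⁻¹) = (ι (C b))⁻¹ := by
          refine eq_inv_of_mul_eq_one_left ?_
          rw [← map_mul, ← C_mul, inv_mul_cancel₀ hb]; simp
        have e : ι (C b⁻¹) * (ι (X - C a) / ι (C b) / (1 + (ι (X - C a) / ι (C b)) ^ 2))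
            = ι (X - C a) / ι Q := by
          rw [hden, hbb]; field_simp
        rwa [e] at h2
      have m3 := ih _ (by omega) (f := 1) hδ (by simp) rfl
      have m4 := ih _ (by omega) (f := f /ₘ Q) hδ
        (by rw [natDegree_divByMonic f hQm, hQd]; omega) rfl
      have e : ι f / ι (Q * δ) = (ι (C s) * (ι (X - C a) / ι Q) + ι (C (s * a + t)) * (ι Q)⁻¹)
          * (ι 1 / ι δ) + ι (f /ₘ Q) / ι δ := by
        conv_lhs => rw [hf]
        rw [map_add, map_add, map_mul, map_mul, map_mul, map_one]
        field_simp
      rw [e]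
      exact add_mem (mul_mem (add_mem (mul_mem (C_mem_dressD _) m2)
        (mul_mem (C_mem_dressD _) m1)) m3) m4

theorem natDegree_add_of_leadingCoeff_pos {f g : ℝ[X]} (hf : 0 < f.leadingCoeff)
    (hg : 0 < g.leadingCoeff) : (f + g).natDegree = max f.natDegree g.natDegree := by
  have h := degree_add_eq_of_leadingCoeff_add_ne_zero (add_pos hf hg).ne'
  have hf0 : f ≠ 0 := by rintro rfl; simp at hf
  have hg0 : g ≠ 0 := by rintro rfl; simp at hg
  rw [natDegree, h, degree_eq_natDegree hf0, degree_eq_natDegree hg0]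
  rcases le_total f.natDegree g.natDegree with h | h
  · rw [max_eq_right h, max_eq_right (by exact_mod_cast h)]; rfl
  · rw [max_eq_left h, max_eq_left (by exact_mod_cast h)]; rfl

theorem exists_div_of_mem_dressD {z : RatFunc ℝ} (hz : z ∈ DressD) :
    ∃ f γ : ℝ[X], (∀ u, γ.eval u ≠ 0) ∧ f.natDegree ≤ γ.natDegree ∧ z = ι f / ι γ := by
  have ne : ∀ {γ : ℝ[X]}, (∀ u, γ.eval u ≠ 0) → γ ≠ 0 := by
    rintro γ h rfl; exact h 0 (by simp)
  induction hz using Subring.closure_induction with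
  | mem z hz =>
    obtain ⟨x, rfl⟩ := hz
    have hd := x.denom_ne_zero
    have hd' : ι x.denom ≠ 0 := by simpa using hd
    have hlt : 0 < (x.denom ^ 2).leadingCoeff := by
      rw [leadingCoeff_pow]
      have := leadingCoeff_ne_zero.2 hd
      positivity
    refine ⟨x.denom ^ 2, x.denom ^ 2 + x.num ^ 2, fun u hu => ?_, ?_, ?_⟩
    · obtain ⟨a, b, hab⟩ := x.isCoprime_num_denom
      have h1 := congrArg (eval u) hab
      simp only [eval_add, eval_mul, eval_pow, eval_one] at hu h1
      have h2 : x.denom.eval u = 0 := by nlinarith [sq_nonneg (x.denom.eval u), sq_nonneg (x.num.eval u)]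
      have h3 : x.num.eval u = 0 := by nlinarith [sq_nonneg (x.denom.eval u), sq_nonneg (x.num.eval u)]
      rw [h2, h3] at h1
      simp at h1
    · by_cases hn : x.num = 0
      · simp [hn]
      · rw [natDegree_add_of_leadingCoeff_pos hlt]
        · exact le_max_left _ _
        · rw [leadingCoeff_pow]
          have := leadingCoeff_ne_zero.2 hn
          positivity
    · conv_lhs => rw [← x.num_div_denom]
      rw [map_add, map_pow, map_pow]
      have : 1 + (ι x.num / ι x.denom) ^ 2 = (ι x.denom ^ 2 + ι x.num ^ 2) / ι x.denom ^ 2 := by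
        field_simp
      rw [this, inv_div]
  | zero => exact ⟨0, 1, by simp, by simp, by simp⟩
  | one => exact ⟨1, 1, by simp, by simp, by simp⟩
  | neg x _ ih =>
    obtain ⟨f, γ, h1, h2, rfl⟩ := ih
    exact ⟨-f, γ, h1, by simpa using h2, by rw [map_neg, neg_div]⟩
  | add x y _ _ ihx ihy =>
    obtain ⟨f, γ, h1, h2, rfl⟩ := ihx
    obtain ⟨g, δ, h3, h4, rfl⟩ := ihy
    refine ⟨f * δ + γ * g, γ * δ, fun u => by simpa using ⟨h1 u, h3 u⟩, ?_, ?_⟩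
    · rw [natDegree_mul (ne h1) (ne h3)]
      refine (natDegree_add_le _ _).trans (max_le ?_ ?_) <;>
        refine natDegree_mul_le.trans ?_ <;> omega
    · have : ι γ ≠ 0 := by simpa using ne h1
      have : ι δ ≠ 0 := by simpa using ne h3
      simp only [map_add, map_mul]
      field_simp
  | mul x y _ _ ihx ihy =>
    obtain ⟨f, γ, h1, h2, rfl⟩ := ihx
    obtain ⟨g, δ, h3, h4, rfl⟩ := ihy
    refine ⟨f * g, γ * δ, fun u => by simpa using ⟨h1 u, h3 u⟩, ?_, ?_⟩
    · rw [natDegree_mul (ne h1) (ne h3)]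
      exact natDegree_mul_le.trans (by omega)
    · simp only [map_mul]
      rw [div_mul_div_comm]

/-- `(x, y)` is a row of elements of the Dress ring which, completed by a zero row, is a product
of idempotent matrices over the Dress ring. -/
def IsDressRow (x y : RatFunc ℝ) : Prop :=
  ∃ (hx : x ∈ DressD) (hy : y ∈ DressD), IsIdempotentRow (⟨x, hx⟩ : DressD) ⟨y, hy⟩

namespace IsDressRow

theorem smul {x y c : RatFunc ℝ} (h : IsDressRow x y) (hc : c ∈ DressD) :
    IsDressRow (c * x) (c * y) := by
  obtain ⟨hx, hy, h⟩ := h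
  exact ⟨mul_mem hc hx, mul_mem hc hy, h.smul ⟨c, hc⟩⟩

theorem add_right {x y t : RatFunc ℝ} (h : IsDressRow x y) (ht : t ∈ DressD) :
    IsDressRow x (y + t * x) := by
  obtain ⟨hx, hy, h⟩ := h
  exact ⟨hx, add_mem hy (mul_mem ht hx), h.add_right ⟨t, ht⟩⟩

theorem add_left {x y t : RatFunc ℝ} (h : IsDressRow x y) (ht : t ∈ DressD) :
    IsDressRow (x + t * y) y := by
  obtain ⟨hx, hy, h⟩ := h
  exact ⟨add_mem hx (mul_mem ht hy), hy, h.add_left ⟨t, ht⟩⟩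

theorem one_zero : IsDressRow 1 0 :=
  ⟨one_mem _, zero_mem _, IsIdempotentRow.single 1⟩

theorem swap {x y : RatFunc ℝ} (h : IsDressRow x y) : IsDressRow y x := by
  obtain ⟨hx, hy, h⟩ := h
  exact ⟨hy, hx, h.swap⟩

theorem of_idempotent {a b c d : RatFunc ℝ} (ha : a ∈ DressD) (hb : b ∈ DressD)
    (hc : c ∈ DressD) (hd : d ∈ DressD) (h₁ : a * a + b * c = a)
    (h₂ : a * b + b * d = b) (h₃ : c * a + d * c = c) (h₄ : c * b + d * d = d) :
    IsDressRow c d := by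
  refine ⟨hc, hd, ?_⟩
  have h := (IsIdempotentRow.single (1 : DressD)).swap.mul_idempotent
    (a := ⟨a, ha⟩) (b := ⟨b, hb⟩) (c := ⟨c, hc⟩) (d := ⟨d, hd⟩)
    (isIdempotentElem_fin_two (Subtype.ext h₁) (Subtype.ext h₂) (Subtype.ext h₃) (Subtype.ext h₄))
  simpa only [zero_mul, one_mul, zero_add] using h

end IsDressRow

theorem eval_sq_add_C_one_pos (a u : ℝ) : 0 < ((X - C a) ^ 2 + C 1 : ℝ[X]).eval u := by
  simp only [eval_add, eval_pow, eval_sub, eval_X, eval_C]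
  positivity

theorem leadingCoeff_sq_pos {g : ℝ[X]} (hg : g ≠ 0) : 0 < (g ^ 2).leadingCoeff := by
  rw [leadingCoeff_pow]
  have := leadingCoeff_ne_zero.2 hg
  positivity

theorem isDressRow_of_nonneg {f g h γ : ℝ[X]} (hγ : ∀ u, γ.eval u ≠ 0)
    (hf : ∀ u, 0 ≤ f.eval u) (hlc : 0 < f.leadingCoeff) (hg : g ≠ 0)
    (hfg : ∀ u, f.eval u = 0 → g.eval u ≠ 0) (hfe : Even f.natDegree) (hge : Even g.natDegree)
    (hdf : h.natDegree + f.natDegree ≤ γ.natDegree)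
    (hdg : h.natDegree + g.natDegree ≤ γ.natDegree) :
    IsDressRow (ι (h * f) / ι γ) (ι (h * g) / ι γ) := by
  obtain ⟨N, hN⟩ : ∃ N, max f.natDegree g.natDegree = 2 * N := by
    obtain ⟨a, ha⟩ := hfe
    obtain ⟨b, hb⟩ := hge
    exact ⟨max a b, by omega⟩
  have hEm : ((X - C 0) ^ 2 + C 1 : ℝ[X]).Monic := leadingCoeff_sq_add_C _ _
  have hEd := natDegree_sq_add_C 0 1
  have hEp := eval_sq_add_C_one_pos 0
  generalize ((X - C 0) ^ 2 + C 1 : ℝ[X]) = E at hEm hEd hEp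
  have hENd : (E ^ N).natDegree = 2 * N := by rw [natDegree_pow, hEd, mul_comm]
  have hEN : ∀ u, (E ^ N).eval u ≠ 0 := fun u => by
    rw [eval_pow]; exact (pow_pos (hEp u) N).ne'
  have hf0 : f ≠ 0 := by rintro rfl; simp at hlc
  obtain ⟨V, hV⟩ : ∃ V, V = f * E ^ N + g ^ 2 := ⟨_, rfl⟩
  have hVd : V.natDegree = 4 * N := by
    rw [hV, natDegree_add_of_leadingCoeff_pos _ (leadingCoeff_sq_pos hg),
      natDegree_mul hf0 (hEm.pow N).ne_zero, hENd, natDegree_pow]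
    · omega
    · rw [leadingCoeff_mul, (hEm.pow N).leadingCoeff, mul_one]; exact hlc
  have hVp : ∀ u, V.eval u ≠ 0 := by
    intro u
    have h1 := pow_pos (hEp u) N
    rw [hV]
    simp only [eval_add, eval_mul, eval_pow]
    rcases (hf u).eq_or_lt with h0 | h0
    · have := hfg u h0.symm
      rw [← h0]
      positivity
    · positivity
  have hE0 : ι E ≠ 0 := by simpa using hEm.ne_zero
  have hγ0 : ι γ ≠ 0 := by
    have : γ ≠ 0 := by rintro rfl; exact hγ 0 (by simp)
    simpa using this
  have hV0 : ι V ≠ 0 := by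
    have : V ≠ 0 := by rintro rfl; exact hVp 0 (by simp)
    simpa using this
  have m1 : ι (g * E ^ N) / ι V ∈ DressD :=
    div_mem_dressD hVp (natDegree_mul_le.trans (by omega))
  have m2 : ι V / ι (E ^ N * E ^ N) ∈ DressD :=
    div_mem_dressD (fun u => by simpa using pow_ne_zero N (hEp u).ne')
      (by rw [natDegree_mul (hEm.pow N).ne_zero (hEm.pow N).ne_zero]; omega)
  have m3 : -(ι g / ι (E ^ N)) ∈ DressD := neg_mem (div_mem_dressD hEN (by omega))
  have m4 : ι (h * E ^ N) / ι γ ∈ DressD :=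
    div_mem_dressD hγ (natDegree_mul_le.trans (by omega))
  have key := (((IsDressRow.one_zero.add_right m1).smul m2).add_left m3).smul m4
  have hVι : ι V = ι f * ι E ^ N + ι g ^ 2 := by rw [hV]; simp
  convert key using 1
  · simp only [map_mul, map_pow]
    field_simp
    rw [hVι]
    ring
  · simp only [map_mul, map_pow]
    field_simp
    ring

theorem isDressRow_of_X_sub_C_mul {f g h γ : ℝ[X]} {u : ℝ} (hγ : ∀ u, γ.eval u ≠ 0)
    (hf : ∀ u, 0 ≤ f.eval u) (hlc : 0 < f.leadingCoeff) (hgu : g.eval u ≠ 0)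
    (hfg : ∀ v, f.eval v = 0 → g.eval v ≠ 0) (hfe : Even f.natDegree) (hgo : Odd g.natDegree)
    (hdf : h.natDegree + f.natDegree + 2 ≤ γ.natDegree)
    (hdg : h.natDegree + g.natDegree + 1 ≤ γ.natDegree) :
    IsDressRow (ι (h * ((X - C u) * f)) / ι γ) (ι (h * g) / ι γ) := by
  obtain ⟨N, hN⟩ : ∃ N, max (f.natDegree + 1) g.natDegree = 2 * N + 1 := by
    obtain ⟨a, ha⟩ := hfe
    obtain ⟨b, hb⟩ := hgo
    exact ⟨max a b, by omega⟩
  have hg : g ≠ 0 := by rintro rfl; simp at hgu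
  have hYd : (X - C u : ℝ[X]).natDegree = 1 := natDegree_X_sub_C u
  have hEm : ((X - C u) ^ 2 + C 1 : ℝ[X]).Monic := leadingCoeff_sq_add_C _ _
  have hEd := natDegree_sq_add_C u 1
  have hEp := eval_sq_add_C_one_pos u
  have hEu : ((X - C u) ^ 2 + C 1 : ℝ[X]).eval u = 1 := by simp
  have hEY : ι ((X - C u) ^ 2 + C 1) = ι (X - C u) ^ 2 + 1 := by simp
  have hY0 : ι (X - C u) ≠ 0 :=
    (map_ne_zero_iff ι (RatFunc.algebraMap_injective ℝ)).2 (X_sub_C_ne_zero u)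
  have hYu : ∀ P : ℝ[X], P.eval u = 0 → ∃ R, P = (X - C u) * R :=
    fun P hP => dvd_iff_isRoot.2 hP
  generalize ((X - C u) ^ 2 + C 1 : ℝ[X]) = E at hEm hEd hEp hEu hEY
  generalize (X - C u : ℝ[X]) = Y at hYd hEY hY0 hYu
  have hY : Y ≠ 0 := by rintro rfl; simp at hYd
  have hENd : (E ^ N).natDegree = 2 * N := by rw [natDegree_pow, hEd, mul_comm]
  have hEN0 := (hEm.pow N).ne_zero
  have hEne : ∀ u, E.eval u ≠ 0 := fun u => (hEp u).ne'
  have hf0 : f ≠ 0 := by rintro rfl; simp at hlc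
  obtain ⟨V, hV⟩ : ∃ V, V = f * (E ^ N * E) + g ^ 2 := ⟨_, rfl⟩
  have hVd : V.natDegree = 4 * N + 2 := by
    rw [hV, natDegree_add_of_leadingCoeff_pos _ (leadingCoeff_sq_pos hg),
      natDegree_mul hf0 (mul_ne_zero hEN0 hEm.ne_zero), natDegree_mul hEN0 hEm.ne_zero,
      hENd, natDegree_pow, hEd]
    · omega
    · rw [leadingCoeff_mul, ((hEm.pow N).mul hEm).leadingCoeff, mul_one]; exact hlc
  have hVp : ∀ u, 0 < V.eval u := by
    intro u
    have h1 := pow_pos (hEp u) N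
    have h2 := hEp u
    rw [hV]
    simp only [eval_add, eval_mul, eval_pow]
    rcases (hf u).eq_or_lt with h0 | h0
    · have := hfg u h0.symm
      rw [← h0]
      positivity
    · positivity
  have hVne : ∀ u, V.eval u ≠ 0 := fun u => (hVp u).ne'
  have hE0 : ι E ≠ 0 := by simpa using hEm.ne_zero
  have hγ0 : ι γ ≠ 0 := by
    have : γ ≠ 0 := by rintro rfl; exact hγ 0 (by simp)
    simpa using this
  have hV0 : ι V ≠ 0 := by
    have : V ≠ 0 := by rintro rfl; exact hVne 0 (by simp)
    simpa using this
  obtain ⟨c, hc⟩ : ∃ c, c = g.eval u / V.eval u := ⟨_, rfl⟩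
  have hc0 : ι (C c) ≠ 0 := by simpa [hc] using ⟨hgu, hVne u⟩
  obtain ⟨R, hR⟩ := hYu (g * (E ^ N * E) - C c * V) (by
    simp only [eval_sub, eval_mul, eval_pow, hEu, eval_C, hc]
    rw [div_mul_cancel₀ _ (hVne u)]
    simp)
  have hRd : R.natDegree ≤ V.natDegree := by
    by_cases hR0 : R = 0
    · simp [hR0]
    have h1 := congrArg natDegree hR
    rw [natDegree_mul hY hR0, hYd] at h1
    have h2 : (g * (E ^ N * E)).natDegree ≤ g.natDegree + (2 * N + 2) := by
      refine natDegree_mul_le.trans ?_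
      have := natDegree_mul_le (p := E ^ N) (q := E)
      omega
    have h3 : (C c * V).natDegree ≤ V.natDegree := natDegree_C_mul_le _ _
    have h4 := natDegree_sub_le (g * (E ^ N * E)) (C c * V)
    omega
  have hYE : ι Y / ι E ∈ DressD := div_mem_dressD hEne (by omega)
  have hcinv : ι (C c⁻¹) = (ι (C c))⁻¹ := by
    refine eq_inv_of_mul_eq_one_left ?_
    rw [← map_mul, ← C_mul, inv_mul_cancel₀ (by simpa using hc0)]; simp
  have base : IsDressRow (ι (C c⁻¹) * (ι Y / ι E)) (ι 1 / ι E) := by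
    refine IsDressRow.of_idempotent (a := ι (Y ^ 2) / ι E) (b := ι (C c) * (ι Y / ι E))
      (div_mem_dressD hEne (by rw [natDegree_pow]; omega)) (mul_mem (C_mem_dressD _) hYE)
      (mul_mem (C_mem_dressD _) hYE) (div_mem_dressD hEne (by simp)) ?_ ?_ ?_ ?_ <;>
    · simp only [hcinv, map_pow, map_one]
      field_simp
      rw [hEY]
  have m1 : ι R / ι V ∈ DressD := div_mem_dressD hVne hRd
  have m2 : ι V / ι (E ^ N * (E ^ N * E)) ∈ DressD :=
    div_mem_dressD (fun u => by simpa using ⟨fun h => absurd h (hEne u), hEne u⟩)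
      (by rw [natDegree_mul hEN0 (mul_ne_zero hEN0 hEm.ne_zero),
            natDegree_mul hEN0 hEm.ne_zero]; omega)
  have m3 : -(ι (Y * g) / ι (E ^ N * E)) ∈ DressD := neg_mem <|
    div_mem_dressD (fun u => by simpa using ⟨fun h => absurd h (hEne u), hEne u⟩)
      (by rw [natDegree_mul hEN0 hEm.ne_zero, natDegree_mul hY hg]; omega)
  have m4 : ι (h * (E ^ N * E)) / ι γ ∈ DressD :=
    div_mem_dressD hγ (natDegree_mul_le.trans (by
      rw [natDegree_mul hEN0 hEm.ne_zero]; omega))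
  have key := ((((base.smul (C_mem_dressD c)).add_right m1).smul m2).add_left m3).smul m4
  have hVι : ι V = ι f * (ι E ^ N * ι E) + ι g ^ 2 := by rw [hV]; simp
  have hRι : ι g * (ι E ^ N * ι E) = ι (C c) * ι V + ι Y * ι R := by
    rw [← map_mul ι (C c), ← map_mul, ← hR, ← map_pow, ← map_mul, ← map_mul, ← map_add]
    congr 1; ring
  have hsnd : ι (C c) * (ι 1 / ι E) + ι R / ι V * (ι (C c) * (ι (C c⁻¹) * (ι Y / ι E)))
      = ι g * ι E ^ N / ι V := by
    rw [hcinv, map_one]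
    field_simp
    linear_combination -hRι
  have hfst : ι (C c) * (ι (C c⁻¹) * (ι Y / ι E)) = ι Y / ι E := by
    rw [hcinv]; field_simp
  rw [hsnd, hfst] at key
  convert key using 1
  · simp only [map_mul, map_pow]
    field_simp
    rw [hVι]
    ring
  · simp only [map_mul, map_pow]
    field_simp

theorem isDressRow_of_pow_mul {f g γ P : ℝ[X]} {u a : ℝ} {m : ℕ} (hγ : ∀ u, γ.eval u ≠ 0)
    (hf : f = C a * ((X - C u) ^ m * P)) (ha : a ≠ 0) (hP : ∀ v, 0 < P.eval v) (hPm : P.Monic)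
    (hg : g ≠ 0) (hfo : Odd f.natDegree) (hgo : Odd g.natDegree)
    (hdf : f.natDegree < γ.natDegree) (hdg : g.natDegree < γ.natDegree) :
    IsDressRow (ι f / ι γ) (ι g / ι γ) := by
  have hPe : Even P.natDegree := (even_natDegree_and_pos fun v => (hP v).ne').1
  have hγe : Even γ.natDegree := (even_natDegree_and_pos hγ).1
  have hYm : (X - C u : ℝ[X]).Monic := monic_X_sub_C u
  have hYd : (X - C u : ℝ[X]).natDegree = 1 := natDegree_X_sub_C u
  have hYk : ∀ k, ((X - C u : ℝ[X]) ^ k).natDegree = k := fun k => by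
    rw [natDegree_pow, hYd, mul_one]
  have hYne : ∀ k, (X - C u : ℝ[X]) ^ k ≠ 0 := fun k => (hYm.pow k).ne_zero
  have hYr : ∀ v, v ≠ u → (X - C u : ℝ[X]).eval v ≠ 0 := fun v hv => by
    simpa using sub_ne_zero.2 hv
  have hfd : f.natDegree = m + P.natDegree := by
    rw [hf, natDegree_C_mul ha, natDegree_mul (hYne m) hPm.ne_zero, hYk]
  obtain ⟨G, hgG, hGu⟩ := g.exists_eq_pow_rootMultiplicity_mul_and_not_dvd hg u
  generalize g.rootMultiplicity u = n at hgG
  replace hGu : G.eval u ≠ 0 := fun h => hGu (dvd_iff_isRoot.2 h)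
  have hG0 : G ≠ 0 := by rintro rfl; simp at hGu
  have hgd : g.natDegree = n + G.natDegree := by
    rw [hgG, natDegree_mul (hYne n) hG0, hYk]
  have hainv : C a * C a⁻¹ = (1 : ℝ[X]) := by rw [← C_mul, mul_inv_cancel₀ ha, C_1]
  have hhd : ∀ k, (C a * (X - C u) ^ k).natDegree = k := fun k => by
    rw [natDegree_C_mul ha, hYk]
  -- evenness of the exponent makes `(X - u) ^ k * P` nonnegative
  have nonneg : ∀ k, Even k → ∀ v, 0 ≤ ((X - C u) ^ k * P).eval v := fun k hk v => by
    rw [eval_mul, eval_pow]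
    exact mul_nonneg (hk.pow_nonneg _) (hP v).le
  have lead : ∀ k, 0 < ((X - C u) ^ k * P).leadingCoeff := fun k => by
    rw [((hYm.pow k).mul hPm).leadingCoeff]; exact one_pos
  have deg : ∀ k, ((X - C u) ^ k * P).natDegree = k + P.natDegree := fun k => by
    rw [natDegree_mul (hYne k) hPm.ne_zero, hYk]
  have degG : ∀ k, (C a⁻¹ * ((X - C u) ^ k * G)).natDegree = k + G.natDegree := fun k => by
    rw [natDegree_C_mul (inv_ne_zero ha), natDegree_mul (hYne k) hG0, hYk]
  have root : ∀ k l, k = 0 ∨ l = 0 → ∀ v, ((X - C u) ^ k * P).eval v = 0 →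
      (C a⁻¹ * ((X - C u) ^ l * G)).eval v ≠ 0 := by
    intro k l hkl v hv
    rw [eval_mul, eval_pow, mul_eq_zero, or_iff_left (hP v).ne'] at hv
    have hvu : v = u := by
      by_contra hvu
      exact pow_ne_zero k (hYr v hvu) hv
    subst hvu
    rcases hkl with rfl | rfl
    · simp at hv
    · simpa using ⟨ha, hGu⟩
  obtain ⟨p', hp'⟩ := hPe
  obtain ⟨m', hm'⟩ := hfo
  obtain ⟨n', hn'⟩ := hgo
  obtain ⟨γ', hγ'⟩ := hγe
  rcases Nat.even_or_odd n with ⟨i, hi⟩ | ⟨i, hi⟩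
  · rcases lt_or_ge n m with hnm | hnm
    · obtain ⟨k, rfl⟩ : ∃ k, m = n + (1 + k) := ⟨m - n - 1, by omega⟩
      have hk : Even k := (Nat.even_iff).2 (by omega)
      convert isDressRow_of_X_sub_C_mul (h := C a * (X - C u) ^ n) (u := u)
        (f := (X - C u) ^ k * P) (g := C a⁻¹ * ((X - C u) ^ 0 * G)) hγ (nonneg k hk) (lead k)
        (by simpa using ⟨ha, hGu⟩) (root _ _ (Or.inr rfl))
        (by rw [deg]; exact hk.add ⟨p', hp'⟩) (by rw [degG, Nat.odd_iff]; omega)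
        (by rw [deg, hhd]; omega) (by rw [degG, hhd]; omega) using 3
      · rw [hf]; ring
      · rw [hgG]; linear_combination (-(X - C u) ^ n * G) * hainv
    · obtain ⟨k, rfl⟩ : ∃ k, n = m + k := ⟨n - m, by omega⟩
      convert isDressRow_of_nonneg (h := C a * (X - C u) ^ m)
        (f := (X - C u) ^ 0 * P) (g := C a⁻¹ * ((X - C u) ^ k * G)) hγ (nonneg 0 Even.zero) (lead 0)
        (mul_ne_zero (C_ne_zero.2 (inv_ne_zero ha)) (mul_ne_zero (hYne k) hG0))
        (root _ _ (Or.inl rfl))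
        (by rw [deg, Nat.even_iff]; omega) (by rw [degG, Nat.even_iff]; omega)
        (by rw [deg, hhd]; omega) (by rw [degG, hhd]; omega) using 3
      · rw [hf]; ring
      · rw [hgG]; linear_combination (-(X - C u) ^ (m + k) * G) * hainv
  · obtain ⟨j, k, l, rfl, rfl, hkl⟩ : ∃ j k l, m = j + k ∧ n = j + l ∧ (k = 0 ∨ l = 0) :=
      ⟨min m n, m - min m n, n - min m n, by omega, by omega, by omega⟩
    have hk : Even k := (Nat.even_iff).2 (by omega)
    convert isDressRow_of_nonneg (h := C a * (X - C u) ^ j)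
      (f := (X - C u) ^ k * P) (g := C a⁻¹ * ((X - C u) ^ l * G)) hγ (nonneg k hk) (lead k)
      (mul_ne_zero (C_ne_zero.2 (inv_ne_zero ha)) (mul_ne_zero (hYne l) hG0))
      (root _ _ hkl)
      (by rw [deg, Nat.even_iff]; omega) (by rw [degG, Nat.even_iff]; omega)
      (by rw [deg, hhd]; omega) (by rw [degG, hhd]; omega) using 3
    · rw [hf]; ring
    · rw [hgG]; linear_combination (-(X - C u) ^ (j + l) * G) * hainv

theorem denom_eval_ne_zero {z : RatFunc ℝ} (hz : z ∈ DressD) (u : ℝ) : z.denom.eval u ≠ 0 := by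
  obtain ⟨f, γ, h1, -, rfl⟩ := exists_div_of_mem_dressD hz
  obtain ⟨δ, hδ⟩ := RatFunc.denom_div_dvd f γ
  intro h
  apply h1 u
  rw [hδ, eval_mul, h, zero_mul]

theorem intDegree_nonpos {z : RatFunc ℝ} (hz : z ∈ DressD) : z.intDegree ≤ 0 := by
  obtain ⟨f, γ, h1, h2, rfl⟩ := exists_div_of_mem_dressD hz
  by_cases hf : f = 0
  · simp [hf]
  have hγ : γ ≠ 0 := by rintro rfl; exact h1 0 (by simp)
  rw [RatFunc.intDegree_div (by simpa using hf) (by simpa using hγ), RatFunc.intDegree_polynomial,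
    RatFunc.intDegree_polynomial]
  omega

theorem evalD_eq_zero_iff (p : DressD) (u : ℝ) :
    evalD p u = 0 ↔ (p : RatFunc ℝ).num.eval u = 0 := by
  have := denom_eval_ne_zero p.2 u
  rw [evalD, RatFunc.eval, eval₂_id, eval₂_id, div_eq_zero_iff, or_iff_left this]

theorem isDressRow_of_existsUnique {x y : RatFunc ℝ} (hx : x ∈ DressD) (hy : y ∈ DressD)
    (hxo : Odd x.intDegree) (hyo : Odd y.intDegree) (hroot : ∃! u, x.num.eval u = 0) :
    IsDressRow x y := by
  have hdx := denom_eval_ne_zero hx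
  have hdy := denom_eval_ne_zero hy
  have hx0 : x ≠ 0 := by rintro rfl; simp at hxo
  have hy0 : y ≠ 0 := by rintro rfl; simp at hyo
  have hnx := RatFunc.num_ne_zero hx0
  have hny := RatFunc.num_ne_zero hy0
  have hxd := intDegree_nonpos hx
  have hyd := intDegree_nonpos hy
  have hex := (even_natDegree_and_pos hdx).1
  have hey := (even_natDegree_and_pos hdy).1
  rw [Nat.even_iff] at hex hey
  rw [RatFunc.intDegree] at hxo hyo hxd hyd
  rw [Int.odd_iff] at hxo hyo
  obtain ⟨u, hu, huniq⟩ := hroot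
  obtain ⟨P, hxP, hPu⟩ := x.num.exists_eq_pow_rootMultiplicity_mul_and_not_dvd hnx u
  generalize x.num.rootMultiplicity u = m at hxP
  obtain ⟨Q, hQ⟩ : ∃ Q, Q = P * y.denom := ⟨_, rfl⟩
  have hQne : ∀ v, Q.eval v ≠ 0 := by
    intro v hv
    rw [hQ, eval_mul, mul_eq_zero, or_iff_left (hdy v)] at hv
    have hvu : v = u := huniq v (by simp only [hxP, eval_mul, hv, mul_zero])
    exact hPu (dvd_iff_isRoot.2 (hvu ▸ hv))
  have hQ0 : Q ≠ 0 := by rintro rfl; exact hQne 0 (by simp)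
  have hlc : Q.leadingCoeff ≠ 0 := leadingCoeff_ne_zero.2 hQ0
  have key := isDressRow_of_pow_mul (f := x.num * y.denom) (g := y.num * x.denom)
    (γ := x.denom * y.denom) (P := Q * C Q.leadingCoeff⁻¹) (u := u) (a := Q.leadingCoeff) (m := m)
    (fun v => by rw [eval_mul]; exact mul_ne_zero (hdx v) (hdy v))
    (by
      have h1 : C Q.leadingCoeff * C Q.leadingCoeff⁻¹ = (1 : ℝ[X]) := by
        rw [← C_mul, mul_inv_cancel₀ hlc, C_1]
      conv_lhs => rw [hxP]
      linear_combination (-(X - C u) ^ m * Q) * h1 - (X - C u) ^ m * hQ)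
    hlc
    (fun v => by
      have h1 := (even_natDegree_and_pos hQne).2 v
      rw [eval_mul, eval_C, ← div_eq_mul_inv]
      have h2 : Q.eval v / Q.leadingCoeff = Q.eval v * Q.leadingCoeff / Q.leadingCoeff ^ 2 := by
        field_simp
      rw [h2]
      positivity)
    (monic_mul_leadingCoeff_inv hQ0) (mul_ne_zero hny x.denom_ne_zero)
    (by rw [natDegree_mul hnx y.denom_ne_zero, Nat.odd_iff]; omega)
    (by rw [natDegree_mul hny x.denom_ne_zero, Nat.odd_iff]; omega)
    (by rw [natDegree_mul hnx y.denom_ne_zero, natDegree_mul x.denom_ne_zero y.denom_ne_zero]; omega)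
    (by rw [natDegree_mul hny x.denom_ne_zero, natDegree_mul x.denom_ne_zero y.denom_ne_zero]; omega)
  have h1 : ι x.denom ≠ 0 := by simpa using x.denom_ne_zero
  have h2 : ι y.denom ≠ 0 := by simpa using y.denom_ne_zero
  convert key using 1
  · conv_lhs => rw [← x.num_div_denom]
    rw [map_mul, map_mul, mul_div_mul_right _ _ h2]
  · conv_lhs => rw [← y.num_div_denom]
    rw [map_mul, map_mul, mul_comm (ι y.num), mul_div_mul_left _ _ h1]

theorem stmt_10 (p q : DressD)
    (hpodd : Odd (RatFunc.intDegree (p : RatFunc ℝ)))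
    (hqodd : Odd (RatFunc.intDegree (q : RatFunc ℝ)))
    (hroot : (∃! u : ℝ, evalD p u = 0) ∨ (∃! u : ℝ, evalD q u = 0)) :
    IsProductOfIdempotents (!![p, q; 0, 0] : Matrix (Fin 2) (Fin 2) DressD) := by
  simp only [evalD_eq_zero_iff] at hroot
  have h : IsDressRow (p : RatFunc ℝ) q := by
    rcases hroot with h | h
    · exact isDressRow_of_existsUnique p.2 q.2 hpodd hqodd h
    · exact (isDressRow_of_existsUnique q.2 p.2 hqodd hpodd h).swap
  obtain ⟨_, _, h⟩ := h
  exact h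
end

section
/- Let x, y ∈ ℝ[X] be polynomials without common real roots such that deg x is even, deg y is odd, deg x > deg y, y has a unique real root y₁, and there exist real roots x₁, x₂ of x with y(x₁)·y(x₂) < 0. Then there exist a real number r and two distinct real numbers z₁, z₂ such that the set of real roots of r·x + y is exactly {z₁, z₂}; moreover, if x(y₁)·l.c.(x) > 0 then x(z₁)·x(z₂) > 0, and if x(y₁)·l.c.(x) < 0 then x(z₁)·x(z₂) < 0. -/
open Polynomial

open Filter Topology Set

/-- A continuous injective function on a preconnected set that tends to `+∞` along a filter
supported on that set takes every large value exactly once. -/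
lemma eventually_existsUnique_eq_of_tendsto_atTop {g : ℝ → ℝ} {S : Set ℝ} {l : Filter ℝ} [l.NeBot]
    (hS : IsPreconnected S) (hc : ContinuousOn g S) (hi : InjOn g S) (hl : S ∈ l)
    (hg : Tendsto g l atTop) : ∀ᶠ t in atTop, ∃ z ∈ S, g z = t ∧ ∀ w ∈ S, g w = t → w = z := by
  obtain ⟨s, hs⟩ := Filter.nonempty_of_mem hl
  filter_upwards [eventually_ge_atTop (g s)] with t ht
  obtain ⟨u, hu, hut⟩ := ((hg.eventually_ge_atTop t).and hl).exists
  obtain ⟨z, hz, rfl⟩ := hS.intermediate_value hs hut hc ⟨ht, hu⟩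
  exact ⟨z, hz, rfl, fun w hw h => hi hw hz h⟩

lemma hasDerivAt_eval_div_eval (x y : ℝ[X]) {u : ℝ} (hu : y.eval u ≠ 0) :
    HasDerivAt (fun v => x.eval v / y.eval v)
      ((derivative x * y - x * derivative y).eval u / y.eval u ^ 2) u := by
  rw [eval_sub, eval_mul, eval_mul]
  exact (x.hasDerivAt u).div (y.hasDerivAt u) hu

lemma continuousOn_eval_div_eval (x y : ℝ[X]) {S : Set ℝ} (hS : ∀ u ∈ S, y.eval u ≠ 0) :
    ContinuousOn (fun v => x.eval v / y.eval v) S :=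
  x.continuous.continuousOn.div y.continuous.continuousOn hS

lemma injOn_eval_div_eval (x y : ℝ[X]) {S : Set ℝ} (hS : S.OrdConnected)
    (hy : ∀ u ∈ S, y.eval u ≠ 0)
    (hp : ∀ u ∈ S, (derivative x * y - x * derivative y).eval u ≠ 0) :
    InjOn (fun v => x.eval v / y.eval v) S := by
  have key : ∀ u ∈ S, ∀ v ∈ S, u < v → x.eval u / y.eval u ≠ x.eval v / y.eval v := by
    intro u hu v hv huv h
    have hsub : Icc u v ⊆ S := hS.out hu hv
    obtain ⟨c, hc, hc0⟩ := exists_hasDerivAt_eq_zero huv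
      ((continuousOn_eval_div_eval x y hy).mono hsub) h
      (fun w hw => hasDerivAt_eval_div_eval x y (hy w (hsub (Ioo_subset_Icc_self hw))))
    have hcS := hsub (Ioo_subset_Icc_self hc)
    exact div_ne_zero (hp c hcS) (pow_ne_zero 2 (hy c hcS)) hc0
  intro u hu v hv h
  rcases lt_trichotomy u v with huv | huv | huv
  · exact (key u hu v hv huv h).elim
  · exact huv
  · exact (key v hv u hu huv h.symm).elim

lemma wronskian_ne_zero_of_tendsto_atTop (x y : ℝ[X]) {a : ℝ} (hy : ∀ u > a, y.eval u ≠ 0)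
    (hg : Tendsto (fun v => x.eval v / y.eval v) atTop atTop) :
    derivative x * y - x * derivative y ≠ 0 := by
  intro h0
  have hd : ∀ u ∈ Ioi a, HasDerivAt (fun v => x.eval v / y.eval v) 0 u := by
    intro u hu
    simpa [h0] using hasDerivAt_eval_div_eval x y (hy u hu)
  obtain ⟨c, hc⟩ := isOpen_Ioi.exists_is_const_of_deriv_eq_zero (𝕜 := ℝ) isPreconnected_Ioi
    (fun u hu => (hd u hu).differentiableAt.differentiableWithinAt)
    (fun u hu => (hd u hu).deriv)
  obtain ⟨u, hu, hua⟩ := ((hg.eventually_gt_atTop c).and (eventually_gt_atTop a)).exists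
  exact hu.ne' (hc u hua)

lemma exists_bound_eval_div_eval (x y : ℝ[X]) {a b : ℝ} (hy : ∀ u ∈ Icc a b, y.eval u ≠ 0) :
    ∃ M, ∀ u ∈ Icc a b, x.eval u / y.eval u ≤ M := by
  obtain ⟨M, hM⟩ := isCompact_Icc.bddAbove_image (continuousOn_eval_div_eval x y hy)
  exact ⟨M, fun u hu => hM (mem_image_of_mem _ hu)⟩

/-- If `x / y` takes every large value exactly once on each of two disjoint sets and is bounded
above elsewhere, then `x - t y` has exactly two real roots for some `t > 0`. -/
lemma exists_level_pair {x y : ℝ[X]} {y₁ M : ℝ} {S T : Set ℝ}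
    (hroot : ∀ u, y.eval u = 0 ↔ u = y₁) (hx : x.eval y₁ ≠ 0) (hST : Disjoint S T)
    (hS₁ : y₁ ∉ S) (hT₁ : y₁ ∉ T)
    (hS : ∀ᶠ t in atTop, ∃ z ∈ S, x.eval z / y.eval z = t ∧
      ∀ w ∈ S, x.eval w / y.eval w = t → w = z)
    (hT : ∀ᶠ t in atTop, ∃ z ∈ T, x.eval z / y.eval z = t ∧
      ∀ w ∈ T, x.eval w / y.eval w = t → w = z)
    (hM : ∀ u, u ≠ y₁ → u ∉ S → u ∉ T → x.eval u / y.eval u ≤ M) :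
    ∃ t > 0, ∃ z₁ ∈ S, ∃ z₂ ∈ T, z₁ ≠ z₂ ∧ ∀ u, x.eval u = t * y.eval u ↔ u = z₁ ∨ u = z₂ := by
  obtain ⟨t, ⟨z, hz, hzt, hzu⟩, ⟨w, hw, hwt, hwu⟩, htM, ht0⟩ :=
    (hS.and (hT.and ((eventually_gt_atTop M).and (eventually_gt_atTop 0)))).exists
  have hne : ∀ {u}, u ≠ y₁ → y.eval u ≠ 0 := fun h h' => h ((hroot _).1 h')
  refine ⟨t, ht0, z, hz, w, hw, fun h => disjoint_left.1 hST hz (h ▸ hw), fun u => ⟨?_, ?_⟩⟩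
  · intro hu
    have hu₁ : u ≠ y₁ := by
      rintro rfl
      exact hx (by rw [hu, (hroot _).2 rfl, mul_zero])
    have hut : x.eval u / y.eval u = t := (div_eq_iff (hne hu₁)).2 hu
    by_cases huS : u ∈ S
    · exact Or.inl (hzu u huS hut)
    by_cases huT : u ∈ T
    · exact Or.inr (hwu u huT hut)
    · exact absurd (hM u hu₁ huS huT) (by rw [hut]; exact not_le.2 htM)
  · rintro (rfl | rfl)
    · exact (div_eq_iff (hne (fun h => hS₁ (h ▸ hz)))).1 hzt
    · exact (div_eq_iff (hne (fun h => hT₁ (h ▸ hw)))).1 hwt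

lemma exists_level_of_tendsto {x y : ℝ[X]} {y₁ : ℝ} (hy : y.eval y₁ = 0) (hx : x.eval y₁ ≠ 0)
    (hpos : ∀ u > y₁, 0 < y.eval u) (hneg : ∀ u < y₁, y.eval u < 0)
    (htop : Tendsto (fun v => x.eval v / y.eval v) atTop atTop)
    (hbot : Tendsto (fun v => x.eval v / y.eval v) atBot atBot) :
    ∃ t > 0, ∃ z₁ z₂ : ℝ, z₁ ≠ z₂ ∧ (∀ u, x.eval u = t * y.eval u ↔ u = z₁ ∨ u = z₂) ∧
      (0 < x.eval y₁ → 0 < x.eval z₁ * x.eval z₂) ∧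
      (x.eval y₁ < 0 → x.eval z₁ * x.eval z₂ < 0) := by
  have hne : ∀ u, u ≠ y₁ → y.eval u ≠ 0 := fun u hu =>
    hu.lt_or_gt.elim (fun h => (hneg u h).ne) (fun h => (hpos u h).ne')
  have hroot : ∀ u, y.eval u = 0 ↔ u = y₁ := fun u =>
    ⟨fun h => by_contra fun hu => hne u hu h, fun h => h ▸ hy⟩
  set p := derivative x * y - x * derivative y
  have hp0 : p ≠ 0 := wronskian_ne_zero_of_tendsto_atTop x y (fun u hu => (hpos u hu).ne') htop
  have hp : ∀ᶠ u in 𝓝[≠] y₁, p.eval u ≠ 0 := by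
    have hfin : {u | p.eval u = 0}.Finite := by
      simpa [IsRoot] using Polynomial.finite_setOfPred_isRoot hp0
    have hfin' := hfin.subset (sdiff_subset (t := {y₁}))
    filter_upwards [mem_nhdsWithin_of_mem_nhds (hfin'.isClosed.isOpen_compl.mem_nhds
      (show y₁ ∈ ({u | p.eval u = 0} \ {y₁})ᶜ by simp)), self_mem_nhdsWithin] with u hu hu' h
    exact hu ⟨h, hu'⟩
  have hy0 : Tendsto (fun u => y.eval u) (𝓝 y₁) (𝓝 0) := hy ▸ y.continuous.tendsto y₁
  have hxc : Tendsto (fun u => x.eval u) (𝓝 y₁) (𝓝 (x.eval y₁)) := x.continuous.tendsto y₁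
  obtain ⟨L, hL⟩ := eventually_atBot.1
    ((hbot.eventually_le_atBot 0).and (eventually_lt_atBot y₁))
  have hend : ∀ b, ∃ R > b, R > y₁ ∧ ∀ᶠ t in atTop, ∃ z ∈ Ici R, x.eval z / y.eval z = t ∧
      ∀ w ∈ Ici R, x.eval w / y.eval w = t → w = z := by
    intro b
    obtain ⟨R, hR⟩ := eventually_atTop.1
      ((p.eventually_atTop_not_isRoot hp0).and ((eventually_gt_atTop b).and (eventually_gt_atTop y₁)))
    have hyR : ∀ u ∈ Ici R, y.eval u ≠ 0 := fun u hu => (hpos u (hR u hu).2.2).ne'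
    exact ⟨R, (hR R le_rfl).2.1, (hR R le_rfl).2.2,
      eventually_existsUnique_eq_of_tendsto_atTop isPreconnected_Ici
        (continuousOn_eval_div_eval x y hyR)
        (injOn_eval_div_eval x y ordConnected_Ici hyR fun u hu => (hR u hu).1)
        (Ici_mem_atTop R) htop⟩
  rcases hx.lt_or_gt with hx | hx
  · have hg : Tendsto (fun v => x.eval v / y.eval v) (𝓝[<] y₁) atTop :=
      (hxc.mono_left nhdsWithin_le_nhds).neg_mul_atBot hx
        (tendsto_inv_nhdsLT_zero.comp (tendsto_nhdsWithin_iff.2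
          ⟨hy0.mono_left nhdsWithin_le_nhds, eventually_mem_nhdsWithin.mono fun u hu => hneg u hu⟩))
    obtain ⟨a, ha, haS⟩ := mem_nhdsLT_iff_exists_Ico_subset.1
      (hp.filter_mono (nhdsWithin_mono y₁ fun u (hu : u < y₁) => hu.ne))
    obtain ⟨b, hb, hbS⟩ := mem_nhdsGT_iff_exists_Ioc_subset.1
      ((hxc.mono_left (nhdsWithin_le_nhds (s := Ioi y₁))).eventually_lt_const hx)
    obtain ⟨R, hRb, hRy, hRt⟩ := hend b
    have hya : ∀ u ∈ Ico a y₁, y.eval u ≠ 0 := fun u hu => (hneg u hu.2).ne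
    have hat := eventually_existsUnique_eq_of_tendsto_atTop isPreconnected_Ico
      (continuousOn_eval_div_eval x y hya) (injOn_eval_div_eval x y ordConnected_Ico hya haS)
      (Ico_mem_nhdsLT ha) hg
    obtain ⟨M, hM⟩ := exists_bound_eval_div_eval x y (a := L) (b := a)
      fun u hu => (hneg u (hu.2.trans_lt ha)).ne
    obtain ⟨N, hN⟩ := exists_bound_eval_div_eval x y (a := b) (b := R)
      fun u hu => (hpos u (lt_of_lt_of_le hb hu.1)).ne'
    obtain ⟨t, ht, z, hz, w, hw, hzw, hall⟩ := exists_level_pair (M := max 0 (max M N))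
      (T := Ici R) hroot hx.ne
      (disjoint_left.2 fun u hu hu' => absurd (hRy.trans_le hu') (not_lt.2 hu.2.le))
      (fun h => lt_irrefl _ h.2) (fun h => absurd hRy (not_lt.2 h)) hat hRt (by
        intro u hu huS huT
        simp only [le_max_iff]
        rcases hu.lt_or_gt with hu | hu
        · rcases le_total u L with h | h
          · exact Or.inl (hL u h).1
          · exact Or.inr (Or.inl (hM u ⟨h, le_of_not_ge fun h' => huS ⟨h', hu⟩⟩))
        · rcases le_total u b with h | h
          · exact Or.inl (div_nonpos_of_nonpos_of_nonneg (le_of_lt (hbS ⟨hu, h⟩)) (hpos u hu).le)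
          · exact Or.inr (Or.inr (hN u ⟨h, le_of_not_ge huT⟩)))
    refine ⟨t, ht, z, w, hzw, hall, fun h => absurd h hx.not_gt, fun _ => ?_⟩
    rw [(hall z).2 (Or.inl rfl), (hall w).2 (Or.inr rfl)]
    exact mul_neg_of_neg_of_pos (mul_neg_of_pos_of_neg ht (hneg z hz.2))
      (mul_pos ht (hpos w (lt_of_lt_of_le hRy hw)))
  · have hg : Tendsto (fun v => x.eval v / y.eval v) (𝓝[>] y₁) atTop :=
      (hxc.mono_left nhdsWithin_le_nhds).pos_mul_atTop hx
        (tendsto_inv_nhdsGT_zero.comp (tendsto_nhdsWithin_iff.2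
          ⟨hy0.mono_left nhdsWithin_le_nhds, eventually_mem_nhdsWithin.mono fun u hu => hpos u hu⟩))
    obtain ⟨b, hb, hbS⟩ := mem_nhdsGT_iff_exists_Ioc_subset.1
      (hp.filter_mono (nhdsWithin_mono y₁ fun u (hu : y₁ < u) => hu.ne'))
    obtain ⟨a, ha, haS⟩ := mem_nhdsLT_iff_exists_Ico_subset.1
      ((hxc.mono_left (nhdsWithin_le_nhds (s := Iio y₁))).eventually_const_lt hx)
    obtain ⟨R, hRb, hRy, hRt⟩ := hend b
    have hyb : ∀ u ∈ Ioc y₁ b, y.eval u ≠ 0 := fun u hu => (hpos u hu.1).ne'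
    have hbt := eventually_existsUnique_eq_of_tendsto_atTop isPreconnected_Ioc
      (continuousOn_eval_div_eval x y hyb) (injOn_eval_div_eval x y ordConnected_Ioc hyb hbS)
      (Ioc_mem_nhdsGT hb) hg
    obtain ⟨M, hM⟩ := exists_bound_eval_div_eval x y (a := L) (b := a)
      fun u hu => (hneg u (hu.2.trans_lt ha)).ne
    obtain ⟨N, hN⟩ := exists_bound_eval_div_eval x y (a := b) (b := R)
      fun u hu => (hpos u (lt_of_lt_of_le hb hu.1)).ne'
    obtain ⟨t, ht, z, hz, w, hw, hzw, hall⟩ := exists_level_pair (M := max 0 (max M N))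
      (T := Ici R) hroot hx.ne'
      (disjoint_left.2 fun u hu hu' => absurd (hRb.trans_le hu') (not_lt.2 hu.2))
      (fun h => lt_irrefl _ h.1) (fun h => absurd hRy (not_lt.2 h)) hbt hRt (by
        intro u hu huS huT
        simp only [le_max_iff]
        rcases hu.lt_or_gt with hu | hu
        · rcases le_total u L with h | h
          · exact Or.inl (hL u h).1
          · rcases le_total u a with h' | h'
            · exact Or.inr (Or.inl (hM u ⟨h, h'⟩))
            · exact Or.inl (div_nonpos_of_nonneg_of_nonpos (le_of_lt (haS ⟨h', hu⟩)) (hneg u hu).le)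
        · exact Or.inr (Or.inr (hN u ⟨le_of_not_ge fun h => huS ⟨hu, h⟩, le_of_not_ge huT⟩)))
    refine ⟨t, ht, z, w, hzw, hall, fun _ => ?_, fun h => absurd h hx.not_gt⟩
    rw [(hall z).2 (Or.inl rfl), (hall w).2 (Or.inr rfl)]
    exact mul_pos (mul_pos ht (hpos z hz.1)) (mul_pos ht (hpos w (lt_of_lt_of_le hRy hw)))

lemma eval_pos_of_forall_gt_ne_zero {y : ℝ[X]} {a : ℝ} (hd : 0 < y.natDegree)
    (hl : 0 < y.leadingCoeff) (hne : ∀ u > a, y.eval u ≠ 0) : ∀ u > a, 0 < y.eval u := by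
  intro u hu
  by_contra! h
  have ht := y.tendsto_atTop_of_leadingCoeff_nonneg (natDegree_pos_iff_degree_pos.1 hd) hl.le
  obtain ⟨v, hv⟩ := (ht.eventually_ge_atTop 0).exists_forall_of_atTop
  obtain ⟨w, hw, hw0⟩ := isPreconnected_Ici.intermediate_value (mem_Ici.2 (le_refl u))
    (mem_Ici.2 (le_max_left u v)) y.continuous.continuousOn ⟨h, hv _ (le_max_right u v)⟩
  exact hne w (lt_of_lt_of_le hu hw) hw0

lemma exists_level_of_leadingCoeff_pos {x y : ℝ[X]} {y₁ : ℝ} (hx : x.eval y₁ ≠ 0)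
    (hxeven : Even x.natDegree) (hyodd : Odd y.natDegree) (hdeg : y.natDegree < x.natDegree)
    (hroot : ∀ u, y.eval u = 0 ↔ u = y₁)
    (hlx : 0 < x.leadingCoeff) (hly : 0 < y.leadingCoeff) :
    ∃ t > 0, ∃ z₁ z₂ : ℝ, z₁ ≠ z₂ ∧ (∀ u, x.eval u = t * y.eval u ↔ u = z₁ ∨ u = z₂) ∧
      (0 < x.eval y₁ → 0 < x.eval z₁ * x.eval z₂) ∧
      (x.eval y₁ < 0 → x.eval z₁ * x.eval z₂ < 0) := by
  have hnd : ∀ q : ℝ[X], (q.comp (-X)).natDegree = q.natDegree := fun q => by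
    simp [natDegree_comp]
  have hlc : ∀ q : ℝ[X], (q.comp (-X)).leadingCoeff = q.leadingCoeff * (-1) ^ q.natDegree :=
    fun q => by rw [leadingCoeff_comp (by simp)]; simp
  have hlx' : (x.comp (-X)).leadingCoeff = x.leadingCoeff := by rw [hlc, hxeven.neg_one_pow, mul_one]
  have hly' : (-y.comp (-X)).leadingCoeff = y.leadingCoeff := by
    rw [leadingCoeff_neg, hlc, hyodd.neg_one_pow]; ring
  have hy0 : y ≠ 0 := leadingCoeff_ne_zero.1 hly.ne'
  apply exists_level_of_tendsto ((hroot y₁).2 rfl) hx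
  · exact eval_pos_of_forall_gt_ne_zero hyodd.pos hly fun u hu h => hu.ne' ((hroot u).1 h)
  · intro u hu
    have := eval_pos_of_forall_gt_ne_zero (y := -y.comp (-X)) (a := -y₁)
      (by rw [natDegree_neg, hnd]; exact hyodd.pos) (by rwa [hly'])
      (fun v hv h => by
        have : -v = y₁ := (hroot _).1 (by simpa using h)
        linarith [show v > -y₁ from hv]) (-u) (by linarith)
    simpa using this
  · exact div_tendsto_atTop_of_degree_gt x y (degree_lt_degree hdeg) hy0 (div_nonneg hlx.le hly.le)
  · have := div_tendsto_atTop_of_degree_gt (x.comp (-X)) (-y.comp (-X))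
      (degree_lt_degree (by rwa [natDegree_neg, hnd, hnd]))
      (leadingCoeff_ne_zero.1 (by rw [hly']; exact hly.ne'))
      (by rw [hlx', hly']; exact div_nonneg hlx.le hly.le)
    have h2 := tendsto_neg_atTop_atBot.comp (this.comp tendsto_neg_atBot_atTop)
    refine h2.congr fun u => ?_
    simp [div_neg]

theorem stmt_11 (x y : Polynomial ℝ) (y₁ : ℝ)
    (hcomax : ¬∃ u : ℝ, x.eval u = 0 ∧ y.eval u = 0)
    (hxeven : Even x.natDegree) (hyodd : Odd y.natDegree)
    (hdeg : y.natDegree < x.natDegree)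
    (hyroot : {u : ℝ | y.eval u = 0} = {y₁})
    (hx12 : ∃ x₁ x₂ : ℝ, x.eval x₁ = 0 ∧ x.eval x₂ = 0 ∧ y.eval x₁ * y.eval x₂ < 0) :
    ∃ r : ℝ, ∃ z₁ z₂ : ℝ, z₁ ≠ z₂ ∧
      {u : ℝ | (C r * x + y).eval u = 0} = {z₁, z₂} ∧
      (0 < x.eval y₁ * x.leadingCoeff → 0 < x.eval z₁ * x.eval z₂) ∧
      (x.eval y₁ * x.leadingCoeff < 0 → x.eval z₁ * x.eval z₂ < 0) := by
  have hroot : ∀ u, y.eval u = 0 ↔ u = y₁ := fun u => Set.ext_iff.1 hyroot u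
  have hx : x.eval y₁ ≠ 0 := fun h => hcomax ⟨y₁, h, (hroot y₁).2 rfl⟩
  have hlx : x.leadingCoeff ≠ 0 := leadingCoeff_ne_zero.2 (by rintro rfl; simp at hx)
  have hly : y.leadingCoeff ≠ 0 := leadingCoeff_ne_zero.2 (by rintro rfl; simp at hyodd)
  obtain ⟨σ, hσ, hσx⟩ : ∃ σ : ℝ, σ * σ = 1 ∧ 0 < σ * x.leadingCoeff := by
    rcases hlx.lt_or_gt with h | h
    · exact ⟨-1, by norm_num, by linarith⟩
    · exact ⟨1, by norm_num, by linarith⟩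
  obtain ⟨τ, hτ, hτy⟩ : ∃ τ : ℝ, τ * τ = 1 ∧ 0 < τ * y.leadingCoeff := by
    rcases hly.lt_or_gt with h | h
    · exact ⟨-1, by norm_num, by linarith⟩
    · exact ⟨1, by norm_num, by linarith⟩
  have hσ0 : σ ≠ 0 := left_ne_zero_of_mul_eq_one hσ
  have hτ0 : τ ≠ 0 := left_ne_zero_of_mul_eq_one hτ
  obtain ⟨t, ht, z₁, z₂, hz, hall, hpos, hneg⟩ :=
    exists_level_of_leadingCoeff_pos (x := C σ * x) (y := C τ * y) (y₁ := y₁)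
      (by simp [hσ0, hx]) (by rwa [natDegree_C_mul hσ0]) (by rwa [natDegree_C_mul hτ0])
      (by rwa [natDegree_C_mul hσ0, natDegree_C_mul hτ0]) (by simpa [hτ0] using hroot)
      (by simpa using hσx) (by simpa using hτy)
  have hprod : (C σ * x).eval z₁ * (C σ * x).eval z₂ = x.eval z₁ * x.eval z₂ := by
    simp only [eval_mul, eval_C]
    linear_combination (x.eval z₁ * x.eval z₂) * hσ
  have hsgn : (C σ * x).eval y₁ * (σ * x.leadingCoeff) = x.eval y₁ * x.leadingCoeff := by
    simp only [eval_mul, eval_C]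
    linear_combination (x.eval y₁ * x.leadingCoeff) * hσ
  rw [hprod] at hpos hneg
  refine ⟨-(σ * τ / t), z₁, z₂, hz, ?_, fun h => hpos ?_, fun h => hneg ?_⟩
  · ext u
    rw [mem_ofPred_eq, mem_insert_iff, mem_singleton_iff, ← hall u]
    simp only [eval_add, eval_mul, eval_C]
    have : -(σ * τ / t) * x.eval u + y.eval u
        = -(τ / t) * (σ * x.eval u - t * (τ * y.eval u)) := by
      field_simp
      linear_combination (-t * y.eval u) * hτ
    rw [this, mul_eq_zero, sub_eq_zero]
    simp [hτ0, ht.ne']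
  · rw [← hsgn] at h
    exact pos_of_mul_pos_left h hσx.le
  · rw [← hsgn] at h
    exact neg_of_mul_neg_left h hσx.le
end

section
/- Let z ∈ ℝ, let k, h be positive integers, let x̄, ȳ ∈ ℝ[X] with x̄(z) ≠ 0 and ȳ(z) ≠ 0, and let γ ∈ ℝ[X] satisfy γ(t) > 0 for every t ∈ ℝ. Suppose that p = (X−z)ᵏ·x̄/γ and q = (X−z)ʰ·ȳ/γ are elements of D with deg p < 0, deg q < 0, deg p even and deg q odd. If either (z is the unique real root of p and ȳ(z)·l.c.(ȳ) > 0) or (z is the unique real root of q and x̄(z)·l.c.(x̄) > 0), then the matrix [[p, q], [0, 0]] ∈ M₂(D) is a product of idempotent matrices over D. -/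
open Polynomial

theorem isProductOfIdempotents_of_mul_eq {R : Type*} [CommRing R] {p q c c' w s : R}
    (hc : c * c' = 1) (h : (c - p) * p = (q - p * w) * s) :
    IsProductOfIdempotents !![p, q; 0, 0] := by
  refine ⟨[!![1, c - 1; 0, 0], !![1, 0; 1, 0], !![1, w; 0, 0],
    !![c' * (p - w * s), c' * (q - w * (c - p) - w ^ 2 * s); c' * s, c' * (c - p + w * s)]],
    ?_, ?_⟩
  · simp only [List.mem_cons, List.not_mem_nil, or_false, forall_eq_or_imp, forall_eq,
      IsIdempotentElem]
    refine ⟨?_, ?_, ?_, ?_⟩ <;> ext i j <;> fin_cases i <;> fin_cases j <;> simp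
    all_goals grind
  · ext i j
    fin_cases i <;> fin_cases j <;> simp
    all_goals grind

theorem isProductOfIdempotents_of_mul_eq_swap {R : Type*} [CommRing R] {p q c c' w s : R}
    (hc : c * c' = 1) (h : (c - q) * q = (p - q * w) * s) :
    IsProductOfIdempotents !![p, q; 0, 0] := by
  refine ⟨[!![1, c; 0, 0], !![0, 0; 0, 1], !![0, 0; w, 1],
    !![c' * (c - q + w * s), c' * s; c' * (p - w * (c - q) - w ^ 2 * s), c' * (q - w * s)]],
    ?_, ?_⟩
  · simp only [List.mem_cons, List.not_mem_nil, or_false, forall_eq_or_imp, forall_eq,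
      IsIdempotentElem]
    refine ⟨?_, ?_, ?_, ?_⟩ <;> ext i j <;> fin_cases i <;> fin_cases j <;> simp
    all_goals grind
  · ext i j
    fin_cases i <;> fin_cases j <;> simp
    all_goals grind

theorem algebraMap_ne_zero_of_eval_ne_zero {γ : ℝ[X]} {t : ℝ} (hγ : γ.eval t ≠ 0) :
    algebraMap ℝ[X] (RatFunc ℝ) γ ≠ 0 := by
  refine RatFunc.algebraMap_ne_zero ?_
  rintro rfl
  simp at hγ

theorem algebraMap_C_mem_DressD (t : ℝ) : algebraMap ℝ[X] (RatFunc ℝ) (C t) ∈ DressD := by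
  let S : Subring ℝ := DressD.comap ((algebraMap ℝ[X] (RatFunc ℝ)).comp C)
  have hunit : ∀ s : ℝ, 0 < s → s ≤ 1 → s ∈ S := by
    intro s hs hs1
    refine Subring.subset_closure ⟨algebraMap _ _ (C √(s⁻¹ - 1)), ?_⟩
    have h1 : (1 : ℝ) + √(s⁻¹ - 1) ^ 2 = s⁻¹ := by
      rw [Real.sq_sqrt (sub_nonneg.2 ((one_le_inv₀ hs).2 hs1))]; ring
    have h2 := congrArg ((algebraMap ℝ[X] (RatFunc ℝ)).comp C) h1
    rw [map_add, map_one, map_pow, map_inv₀] at h2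
    simp only [RingHom.comp_apply] at h2 ⊢
    rw [h2, inv_inv]
  have hpos : ∀ s : ℝ, 0 < s → s ∈ S := by
    intro s hs
    obtain ⟨n, hn⟩ := exists_nat_ge s
    have hn0 : (0 : ℝ) < n := hs.trans_le hn
    have := S.mul_mem (natCast_mem S n) (hunit (s / n) (by positivity) ((div_le_one hn0).2 hn))
    rwa [mul_div_cancel₀ _ hn0.ne'] at this
  change t ∈ S
  rcases lt_trichotomy t 0 with h | rfl | h
  · simpa using S.neg_mem (hpos (-t) (by linarith))
  · exact S.zero_mem
  · exact hpos t h

theorem inv_one_add_sq_mem_DressD (P : ℝ[X]) :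
    (algebraMap ℝ[X] (RatFunc ℝ) (1 + P ^ 2))⁻¹ ∈ DressD :=
  Subring.subset_closure ⟨algebraMap _ _ P, by simp⟩

theorem div_one_add_sq_mem_DressD (P : ℝ[X]) :
    algebraMap ℝ[X] (RatFunc ℝ) P / algebraMap ℝ[X] (RatFunc ℝ) (1 + P ^ 2) ∈ DressD := by
  have h0 : algebraMap ℝ[X] (RatFunc ℝ) (1 + P ^ 2) ≠ 0 :=
    algebraMap_ne_zero_of_eval_ne_zero (t := 0) (by simp; positivity)
  have hhalf : algebraMap ℝ[X] (RatFunc ℝ) (C (1 / 2)) = 1 / 2 := by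
    rw [eq_div_iff two_ne_zero, ← map_ofNat (algebraMap ℝ[X] (RatFunc ℝ)) 2, ← map_mul,
      ← map_ofNat C 2, ← C_mul]
    norm_num
  by_cases hP : P = -1
  · subst hP
    have := DressD.neg_mem (inv_one_add_sq_mem_DressD (-1))
    simpa [neg_div] using this
  have h1 : algebraMap ℝ[X] (RatFunc ℝ) (1 + P) ≠ 0 :=
    RatFunc.algebraMap_ne_zero fun h => hP (by linear_combination h)
  have hmem : (1 + ((1 - algebraMap ℝ[X] (RatFunc ℝ) P) / (1 + algebraMap ℝ[X] (RatFunc ℝ) P)) ^ 2)⁻¹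
      ∈ DressD := Subring.subset_closure ⟨_, rfl⟩
  have := DressD.sub_mem hmem (algebraMap_C_mem_DressD (1 / 2))
  rw [hhalf] at this
  convert this using 1
  simp only [map_add, map_one, map_pow] at h0 h1 ⊢
  generalize algebraMap ℝ[X] (RatFunc ℝ) P = x at *
  have h2 : (1 + x) ^ 2 + (1 - x) ^ 2 ≠ 0 := by
    have : (1 + x) ^ 2 + (1 - x) ^ 2 = 2 * (1 + x ^ 2) := by ring
    rw [this]; exact mul_ne_zero two_ne_zero h0
  field_simp
  ring

theorem exists_eq_sq_add_sq_of_irreducible {Q : ℝ[X]} (hQ : Q.Monic) (hirr : Irreducible Q)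
    (hroot : ∀ t, Q.eval t ≠ 0) :
    ∃ a b : ℝ, b ≠ 0 ∧ Q = (X - C a) ^ 2 + C b ^ 2 := by
  have hdeg : Q.natDegree ≤ 2 := natDegree_le_of_degree_le hirr.degree_le_two
  have h2 : Q.natDegree = 2 := by
    have h0 := hirr.natDegree_pos
    have h1 : Q.natDegree ≠ 1 := by
      intro h
      obtain ⟨x, hx⟩ := exists_root_of_degree_eq_one (degree_eq_iff_natDegree_eq_of_pos one_pos |>.2 h)
      exact hroot x hx
    omega
  have hc : Q.coeff 2 = 1 := by rw [← h2]; exact hQ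
  have hQe : Q = X ^ 2 + C (Q.coeff 1) * X + C (Q.coeff 0) := by
    have := eq_quadratic_of_degree_le_two hirr.degree_le_two
    rwa [hc, C_1, one_mul] at this
  generalize Q.coeff 1 = β, Q.coeff 0 = δ at hQe
  have hd : 0 < δ - β ^ 2 / 4 := by
    by_contra! hle
    refine hroot (-β / 2 + √(β ^ 2 / 4 - δ)) ?_
    have := Real.sq_sqrt (show 0 ≤ β ^ 2 / 4 - δ by linarith)
    rw [hQe]
    simp
    linear_combination this
  refine ⟨-β / 2, √(δ - β ^ 2 / 4), (Real.sqrt_pos.2 hd).ne', ?_⟩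
  rw [hQe, ← C_pow, Real.sq_sqrt hd.le]
  apply Polynomial.funext
  intro t
  simp
  ring

theorem linear_div_sq_add_sq_mem_DressD {a b : ℝ} (hb : b ≠ 0) {P : ℝ[X]} (hP : P.natDegree ≤ 1) :
    algebraMap ℝ[X] (RatFunc ℝ) P / algebraMap ℝ[X] (RatFunc ℝ) ((X - C a) ^ 2 + C b ^ 2)
      ∈ DressD := by
  obtain ⟨c, d, rfl⟩ := exists_eq_X_add_C_of_natDegree_le_one hP
  have h1 := inv_one_add_sq_mem_DressD (C b⁻¹ * (X - C a))
  have h2 := div_one_add_sq_mem_DressD (C b⁻¹ * (X - C a))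
  have hQ : (X - C a) ^ 2 + C b ^ 2 = C (b ^ 2) * (1 + (C b⁻¹ * (X - C a)) ^ 2) := by
    apply Polynomial.funext
    intro t
    simp
    field_simp
    ring
  have hN : C c * X + C d = C (b ^ 2) * (C (c / b) * (C b⁻¹ * (X - C a)) + C ((a * c + d) / b ^ 2)) := by
    apply Polynomial.funext
    intro t
    simp
    field_simp
    ring
  have hb2 : algebraMap ℝ[X] (RatFunc ℝ) (C (b ^ 2)) ≠ 0 :=
    RatFunc.algebraMap_ne_zero (C_ne_zero.2 (pow_ne_zero 2 hb))
  rw [hQ, hN, map_mul, map_mul, mul_div_mul_left _ _ hb2]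
  generalize C b⁻¹ * (X - C a) = W at *
  rw [map_add, map_mul, add_div, mul_div_assoc, div_eq_mul_inv (algebraMap ℝ[X] _ (C _))]
  exact DressD.add_mem (DressD.mul_mem (algebraMap_C_mem_DressD _) h2)
    (DressD.mul_mem (algebraMap_C_mem_DressD _) h1)

theorem div_mem_DressD {γ : ℝ[X]} (hγ : ∀ t, γ.eval t ≠ 0) {P : ℝ[X]}
    (hP : P.natDegree ≤ γ.natDegree) :
    algebraMap ℝ[X] (RatFunc ℝ) P / algebraMap ℝ[X] (RatFunc ℝ) γ ∈ DressD := by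
  induction hn : γ.natDegree using Nat.strong_induction_on generalizing γ P with
  | _ n ih =>
  subst hn
  rcases Nat.eq_zero_or_pos γ.natDegree with h0 | h0
  · rw [eq_C_of_natDegree_eq_zero h0, eq_C_of_natDegree_le_zero (hP.trans h0.le), div_eq_mul_inv]
    have : (algebraMap ℝ[X] (RatFunc ℝ) (C (γ.coeff 0)))⁻¹
        = algebraMap ℝ[X] (RatFunc ℝ) (C (γ.coeff 0)⁻¹) :=
      (map_inv₀ ((algebraMap ℝ[X] (RatFunc ℝ)).comp C) _).symm
    rw [this]
    exact DressD.mul_mem (algebraMap_C_mem_DressD _) (algebraMap_C_mem_DressD _)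
  obtain ⟨Q, hQm, hQi, δ, rfl⟩ := exists_monic_irreducible_factor γ
    (fun h => h0.ne' (natDegree_eq_zero_of_isUnit h))
  have hQr : ∀ t, Q.eval t ≠ 0 := fun t h => hγ t (by simp [h])
  have hδr : ∀ t, δ.eval t ≠ 0 := fun t h => hγ t (by simp [h])
  have hδ0 : δ ≠ 0 := by
    rintro rfl
    simp at h0
  have hdeg : (Q * δ).natDegree = Q.natDegree + δ.natDegree := natDegree_mul hQm.ne_zero hδ0
  have hlt : δ.natDegree < (Q * δ).natDegree := by
    have := hQi.natDegree_pos
    omega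
  have hδ1 := ih _ hlt hδr (P := 1) (by simp) rfl
  have hquot := ih _ hlt hδr (P := P /ₘ Q) (by rw [natDegree_divByMonic _ hQm]; omega) rfl
  have hrem : (P %ₘ Q).natDegree < Q.natDegree :=
    natDegree_modByMonic_lt _ hQm (fun h => hQi.not_isUnit (h ▸ isUnit_one))
  obtain ⟨a, b, hb, hQe⟩ := exists_eq_sq_add_sq_of_irreducible hQm hQi hQr
  have hQ2 : Q.natDegree ≤ 2 := natDegree_le_of_degree_le hQi.degree_le_two
  have hlin := linear_div_sq_add_sq_mem_DressD (a := a) hb (P := P %ₘ Q) (by omega)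
  rw [← hQe] at hlin
  convert DressD.add_mem hquot (DressD.mul_mem hlin hδ1) using 1
  have e1 := algebraMap_ne_zero_of_eval_ne_zero (hQr 0)
  have e2 := algebraMap_ne_zero_of_eval_ne_zero (hδr 0)
  nth_rewrite 1 [← modByMonic_add_div P Q]
  simp only [map_add, map_mul, map_one]
  field_simp
  ring

theorem eventually_atTop_eval_pos {P : ℝ[X]} (hP : 0 < P.leadingCoeff) :
    ∀ᶠ x in Filter.atTop, 0 < P.eval x := by
  rcases Nat.eq_zero_or_pos P.natDegree with h0 | h0
  · rw [leadingCoeff, h0] at hP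
    rw [eq_C_of_natDegree_eq_zero h0]
    exact Filter.Eventually.of_forall fun x => by simpa using hP
  · exact (P.tendsto_atTop_of_leadingCoeff_nonneg (natDegree_pos_iff_degree_pos.1 h0)
      hP.le).eventually_gt_atTop 0

theorem eventually_atBot_eval_pos {P : ℝ[X]} (hP : 0 < P.leadingCoeff * (-1) ^ P.natDegree) :
    ∀ᶠ x in Filter.atBot, 0 < P.eval x := by
  have hlc : 0 < (P.comp (-X)).leadingCoeff := by
    rw [leadingCoeff_comp (by simp)]
    simpa using hP
  filter_upwards [Filter.tendsto_neg_atBot_atTop.eventually (eventually_atTop_eval_pos hlc)]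
    with x hx
  simpa using hx

theorem eval_mul_leadingCoeff_pos {P : ℝ[X]} (hP : ∀ t, P.eval t ≠ 0) (z : ℝ) :
    0 < P.eval z * P.leadingCoeff := by
  have key : ∀ Q : ℝ[X], (∀ t, Q.eval t ≠ 0) → 0 < Q.leadingCoeff → 0 < Q.eval z := by
    intro Q hQ hlc
    by_contra! hle
    obtain ⟨y, hy, hzy⟩ := ((eventually_atTop_eval_pos hlc).and
      (Filter.eventually_ge_atTop z)).exists
    obtain ⟨x, -, hx⟩ := intermediate_value_Icc hzy Q.continuous.continuousOn ⟨hle, hy.le⟩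
    exact hQ x hx
  have hP0 : P.leadingCoeff ≠ 0 := by
    rw [leadingCoeff_ne_zero]
    rintro rfl
    exact hP 0 (by simp)
  rcases hP0.lt_or_gt with h | h
  · have := key (-P) (by simpa using hP) (by simpa using h)
    rw [eval_neg] at this
    nlinarith
  · exact mul_pos (key P hP h) h

/-- A polynomial that is positive at `z` and near `±∞` becomes positive everywhere after adding a
large multiple of the square of a polynomial not vanishing outside `z`. -/
theorem exists_forall_eval_add_mul_sq_pos {Y E B : ℝ[X]} {z : ℝ} (hz : 0 < Y.eval z)
    (hlc : 0 < Y.leadingCoeff) (heven : Even Y.natDegree) (hE : ∀ t, t ≠ z → E.eval t ≠ 0)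
    (hB : ∀ t, 0 < B.eval t) :
    ∃ c : ℝ, 0 < c ∧ ∀ t, 0 < (Y * B + C c * E ^ 2).eval t := by
  obtain ⟨b, hb⟩ := Filter.eventually_atTop.1 (eventually_atTop_eval_pos hlc)
  obtain ⟨a, ha⟩ := Filter.eventually_atBot.1
    (eventually_atBot_eval_pos (P := Y) (by simpa [heven.neg_one_pow] using hlc))
  let K : Set ℝ := Set.Icc a b ∩ {t | Y.eval t ≤ 0}
  have hK : IsCompact K := isCompact_Icc.inter_right (isClosed_le Y.continuous continuous_const)
  have hEK : ∀ t ∈ K, E.eval t ≠ 0 := by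
    rintro t ⟨-, ht⟩
    refine hE t ?_
    rintro rfl
    exact not_le.2 hz ht
  obtain ⟨M, hM⟩ := hK.bddAbove_image (f := fun t => -(Y.eval t * B.eval t) / E.eval t ^ 2)
    (((Y.continuous.mul B.continuous).neg.continuousOn).div
      (E.continuous.pow 2).continuousOn fun t ht => pow_ne_zero 2 (hEK t ht))
  refine ⟨max M 0 + 1, by positivity, fun t => ?_⟩
  simp only [eval_add, eval_mul, eval_C, eval_pow]
  by_cases ht : Y.eval t ≤ 0
  · have htK : t ∈ K := by
      refine ⟨⟨?_, ?_⟩, ht⟩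
      · by_contra! h
        exact not_le.2 (ha t h.le) ht
      · by_contra! h
        exact not_le.2 (hb t h.le) ht
    have h1 : 0 < E.eval t ^ 2 := by have := hEK t htK; positivity
    have h2 := hM ⟨t, htK, rfl⟩
    rw [div_le_iff₀ h1] at h2
    nlinarith [le_max_left M 0]
  · push Not at ht
    have := mul_pos ht (hB t)
    positivity

theorem exists_lt_eval_mul_lt {A E : ℝ[X]} {z : ℝ} (hlc : 0 < A.leadingCoeff)
    (hdeg : E.natDegree < A.natDegree) (hodd : Odd A.natDegree) (c d : ℝ) (hd : 0 < d) :
    ∃ u < z, A.eval u * d < c * E.eval u := by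
  have h1 : (C c * E).natDegree < (C d * A).natDegree := by
    rw [natDegree_C_mul hd.ne']
    exact (natDegree_C_mul_le _ _).trans_lt hdeg
  have h2 : (C c * E - C d * A).natDegree = A.natDegree := by
    rw [natDegree_sub_eq_right_of_natDegree_lt h1, natDegree_C_mul hd.ne']
  have h3 : (C c * E - C d * A).leadingCoeff = -(d * A.leadingCoeff) := by
    rw [leadingCoeff_sub_of_degree_lt' (degree_lt_degree h1)]
    simp
  obtain ⟨u, hu, huz⟩ := ((eventually_atBot_eval_pos (P := C c * E - C d * A)
    (by rw [h2, h3, hodd.neg_one_pow]; nlinarith [mul_pos hd hlc])).and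
      (Filter.eventually_lt_atBot z)).exists
  refine ⟨u, huz, ?_⟩
  simp at hu
  linarith

theorem exists_eq_mul_even_of_eval_pos {N : ℝ[X]} {z : ℝ} (hz : 0 < N.eval z)
    (hlc : 0 < N.leadingCoeff) (h : Even N.natDegree ∨ ∃ u < z, N.eval u = 0) :
    ∃ U Y : ℝ[X], N = U * Y ∧ 0 < Y.eval z ∧ 0 < Y.leadingCoeff ∧ Even Y.natDegree ∧
      (U = 1 ∨ ∃ u, u ≠ z ∧ U = X - C u) := by
  by_cases hev : Even N.natDegree
  · exact ⟨1, N, by simp, hz, hlc, hev, .inl rfl⟩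
  obtain ⟨u, huz, hu⟩ := h.resolve_left hev
  obtain ⟨Y, rfl⟩ := dvd_iff_isRoot.2 hu
  have hY : Y ≠ 0 := by
    rintro rfl
    simp at hz
  rw [natDegree_mul (X_sub_C_ne_zero u) hY, natDegree_X_sub_C, add_comm,
    Nat.even_add_one, not_not] at hev
  refine ⟨X - C u, Y, rfl, ?_, ?_, ?_, .inr ⟨u, huz.ne, rfl⟩⟩
  · simp only [eval_mul, eval_sub, eval_X, eval_C] at hz
    exact pos_of_mul_pos_right hz (by linarith)
  · simpa using hlc
  · exact hev

theorem exists_add_C_mul_eq_mul_even {A P E : ℝ[X]} {z : ℝ} {m : ℕ} (hP : ∀ t, P.eval t ≠ 0)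
    (hE : E = P ^ 2 * (X - C z) ^ m) (hlc : 0 < A.leadingCoeff) (hz : 0 < m → 0 < A.eval z)
    (hodd : Odd (A.natDegree + E.natDegree)) :
    ∃ (M : ℝ) (U Y : ℝ[X]), A + C M * E = U * Y ∧ 0 < Y.eval z ∧ 0 < Y.leadingCoeff ∧
      Even Y.natDegree ∧ E.natDegree ≤ U.natDegree + Y.natDegree ∧
      (U = 1 ∨ ∃ u, u ≠ z ∧ U = X - C u) := by
  have hP0 : P ≠ 0 := by
    rintro rfl
    exact hP 0 (by simp)
  have hElc : 0 < E.leadingCoeff := by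
    rw [hE, leadingCoeff_mul, leadingCoeff_pow, (monic_X_sub_C z).pow m |>.leadingCoeff, mul_one]
    have := leadingCoeff_ne_zero.2 hP0
    positivity
  have hEdeg : E.natDegree = 2 * P.natDegree + m := by
    rw [hE, natDegree_mul (pow_ne_zero 2 hP0) (pow_ne_zero m (X_sub_C_ne_zero z)), natDegree_pow,
      natDegree_pow, natDegree_X_sub_C, mul_one]
  have hEeval : ∀ t, E.eval t = P.eval t ^ 2 * (t - z) ^ m := fun t => by simp [hE]
  have hEz : 0 < m → E.eval z = 0 := fun hm => by simp [hEeval, hm.ne']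
  suffices H : ∃ M : ℝ, 0 < (A + C M * E).eval z ∧ 0 < (A + C M * E).leadingCoeff ∧
      E.natDegree ≤ (A + C M * E).natDegree ∧
      (Even (A + C M * E).natDegree ∨ ∃ u < z, (A + C M * E).eval u = 0) by
    obtain ⟨M, h1, h2, h3, h4⟩ := H
    obtain ⟨U, Y, h5, h6, h7, h8, h9⟩ := exists_eq_mul_even_of_eval_pos h1 h2 h4
    refine ⟨M, U, Y, h5, h6, h7, h8, ?_, h9⟩
    rw [h5] at h3
    exact h3.trans natDegree_mul_le
  rcases lt_trichotomy A.natDegree E.natDegree with hlt | heq | hlt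
  · have hdeg : ∀ M : ℝ, 0 < M → (A + C M * E).natDegree = E.natDegree := fun M hM => by
      rw [natDegree_add_eq_right_of_natDegree_lt (by rwa [natDegree_C_mul hM.ne']),
        natDegree_C_mul hM.ne']
    have hlc' : ∀ M : ℝ, 0 < M → 0 < (A + C M * E).leadingCoeff := fun M hM => by
      rw [leadingCoeff_add_of_degree_lt (degree_lt_degree (by rwa [natDegree_C_mul hM.ne']))]
      simpa using mul_pos hM hElc
    rcases Nat.even_or_odd m with hm | hm
    · obtain ⟨M, hM, hMz⟩ : ∃ M : ℝ, 0 < M ∧ 0 < (A + C M * E).eval z := by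
        rcases Nat.eq_zero_or_pos m with rfl | hm0
        · have h1 : 0 < E.eval z := by
            have := hP z
            rw [hEeval]
            positivity
          refine ⟨(|A.eval z| + 1) / E.eval z, by positivity, ?_⟩
          simp only [eval_add, eval_mul, eval_C]
          rw [div_mul_cancel₀ _ h1.ne']
          linarith [neg_abs_le (A.eval z)]
        · exact ⟨1, one_pos, by simpa [hEz hm0] using hz hm0⟩
      refine ⟨M, hMz, hlc' M hM, (hdeg M hM).ge, .inl ?_⟩
      rw [hdeg M hM, hEdeg]
      exact (even_two_mul _).add hm
    · have hAz := hz hm.pos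
      obtain ⟨u, huA, huz⟩ := (((A.continuous.tendsto z).eventually (lt_mem_nhds hAz)).filter_mono
        nhdsWithin_le_nhds |>.and (self_mem_nhdsWithin (s := Set.Iio z))).exists
      have hEu : E.eval u < 0 := by
        rw [hEeval]
        have := hP u
        exact mul_neg_of_pos_of_neg (by positivity) (hm.pow_neg (sub_neg.2 huz))
      have hM : 0 < -A.eval u / E.eval u := div_pos_of_neg_of_neg (by linarith) hEu
      refine ⟨_, ?_, hlc' _ hM, (hdeg _ hM).ge, .inr ⟨u, huz, ?_⟩⟩
      · simpa [hEz hm.pos] using hAz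
      · simp only [eval_add, eval_mul, eval_C]
        rw [div_mul_cancel₀ _ hEu.ne]
        ring
  · exact absurd hodd (by simp [heq])
  · have hdeg' : ∀ M : ℝ, (C M * E).natDegree < A.natDegree := fun M =>
      (natDegree_C_mul_le _ _).trans_lt hlt
    have hdeg : ∀ M : ℝ, (A + C M * E).natDegree = A.natDegree := fun M =>
      natDegree_add_eq_left_of_natDegree_lt (hdeg' M)
    have hlc' : ∀ M : ℝ, 0 < (A + C M * E).leadingCoeff := fun M => by
      rwa [leadingCoeff_add_of_degree_lt' (degree_lt_degree (hdeg' M))]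
    rcases Nat.even_or_odd m with hm | hm
    · have hAodd : Odd A.natDegree :=
        (Nat.odd_add.1 hodd).2 (hEdeg ▸ (even_two_mul _).add hm)
      obtain ⟨u, huz, hEu, hu⟩ : ∃ u < z, 0 < E.eval u ∧
          A.eval u * E.eval z < A.eval z * E.eval u := by
        have hEpos : ∀ u < z, 0 < E.eval u := fun u hu => by
          rw [hEeval]
          have := hP u
          have := hm.pow_pos (sub_neg.2 hu).ne
          positivity
        rcases Nat.eq_zero_or_pos m with rfl | hm0
        · have h1 : 0 < E.eval z := by
            have := hP z
            rw [hEeval]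
            positivity
          obtain ⟨u, huz, hu⟩ := exists_lt_eval_mul_lt (z := z) hlc hlt hAodd (A.eval z) _ h1
          exact ⟨u, huz, hEpos u huz, hu⟩
        · refine ⟨z - 1, by linarith, hEpos _ (by linarith), ?_⟩
          rw [hEz hm0, mul_zero]
          exact mul_pos (hz hm0) (hEpos _ (by linarith))
      refine ⟨-A.eval u / E.eval u, ?_, hlc' _, by rw [hdeg]; exact hlt.le, .inr ⟨u, huz, ?_⟩⟩
      · simp only [eval_add, eval_mul, eval_C]
        have : A.eval z + -A.eval u / E.eval u * E.eval z
            = (A.eval z * E.eval u - A.eval u * E.eval z) / E.eval u := by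
          field_simp
          ring
        rw [this]
        exact div_pos (sub_pos.2 hu) hEu
      · simp only [eval_add, eval_mul, eval_C]
        rw [div_mul_cancel₀ _ hEu.ne']
        ring
    · refine ⟨0, by simpa using hz hm.pos, hlc' 0, by rw [hdeg]; exact hlt.le, .inl ?_⟩
      rw [hdeg]
      rw [hEdeg] at hodd
      grind

/-- The core construction: `g - f * w` divides `(c - f) * f` for some `w` in the Dress ring and some
nonzero constant `c`, where `f = (X - z) ^ k * P / γ` and `g = (X - z) ^ h * Q / γ`. -/
theorem exists_mul_eq_of_leadingCoeff_pos {z : ℝ} {k h : ℕ} {P Q γ : ℝ[X]} (hk : 0 < k)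
    (hP : ∀ t, P.eval t ≠ 0) (hγ : ∀ t, 0 < γ.eval t)
    (hz : 0 < (P * Q).eval z) (hlc : 0 < (P * Q).leadingCoeff)
    (hF : ((X - C z) ^ k * P).natDegree ≤ γ.natDegree)
    (hodd : Odd (((X - C z) ^ k * P).natDegree + ((X - C z) ^ h * Q).natDegree))
    {f g : DressD}
    (hf : (f : RatFunc ℝ) = algebraMap ℝ[X] (RatFunc ℝ) ((X - C z) ^ k * P) /
      algebraMap ℝ[X] (RatFunc ℝ) γ)
    (hg : (g : RatFunc ℝ) = algebraMap ℝ[X] (RatFunc ℝ) ((X - C z) ^ h * Q) /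
      algebraMap ℝ[X] (RatFunc ℝ) γ) :
    ∃ c c' w s : DressD, c * c' = 1 ∧ (c - f) * f = (g - f * w) * s := by
  have hP0 : P ≠ 0 := by
    rintro rfl
    exact hP 0 (by simp)
  have hQ0 : Q ≠ 0 := by
    rintro rfl
    simp at hz
  have hXz : ∀ n : ℕ, (X - C z) ^ n ≠ 0 := fun n => pow_ne_zero n (X_sub_C_ne_zero z)
  obtain ⟨F, hFdef⟩ : ∃ F, F = (X - C z) ^ k * P := ⟨_, rfl⟩
  obtain ⟨G, hGdef⟩ : ∃ G, G = (X - C z) ^ h * Q := ⟨_, rfl⟩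
  obtain ⟨E, hEdef⟩ : ∃ E, E = P ^ 2 * (X - C z) ^ (k - h) := ⟨_, rfl⟩
  obtain ⟨A, hAdef⟩ : ∃ A, A = (X - C z) ^ (h - k) * (P * Q) := ⟨_, rfl⟩
  rw [← hFdef] at hF hodd hf
  rw [← hGdef] at hodd hg
  have hF0 : F ≠ 0 := hFdef ▸ mul_ne_zero (hXz _) hP0
  have hE0 : E ≠ 0 := hEdef ▸ mul_ne_zero (pow_ne_zero 2 hP0) (hXz _)
  have hA0 : A ≠ 0 := hAdef ▸ mul_ne_zero (hXz _) (mul_ne_zero hP0 hQ0)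
  have hG0 : G ≠ 0 := hGdef ▸ mul_ne_zero (hXz _) hQ0
  have hGE : G * E = A * F := by
    have : (X - C z) ^ h * (X - C z) ^ (k - h) = (X - C z) ^ (h - k) * (X - C z) ^ k := by
      rw [← pow_add, ← pow_add]
      congr 1
      omega
    rw [hGdef, hEdef, hAdef, hFdef]
    linear_combination Q * P ^ 2 * this
  have hAlc : 0 < A.leadingCoeff := by
    rwa [hAdef, leadingCoeff_mul, (monic_X_sub_C z).pow _ |>.leadingCoeff, one_mul]
  have hAz : 0 < k - h → 0 < A.eval z := by
    intro hkh
    have : h - k = 0 := by omega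
    rwa [hAdef, this, pow_zero, one_mul]
  have hAodd : Odd (A.natDegree + E.natDegree) := by
    have := congrArg natDegree hGE
    rw [natDegree_mul hG0 hE0, natDegree_mul hA0 hF0] at this
    grind
  have hEne : ∀ t, t ≠ z → E.eval t ≠ 0 := by
    intro t ht
    have := sub_ne_zero.2 ht
    have := hP t
    simp [*]
  obtain ⟨M, U, Y, hAM, hYz, hYlc, hYev, hEdeg, hU⟩ :=
    exists_add_C_mul_eq_mul_even hP hEdef hAlc hAz hAodd
  have hU1 : U.natDegree ≤ 1 := by
    rcases hU with rfl | ⟨u, -, rfl⟩ <;> simp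
  obtain ⟨B, hBdef⟩ : ∃ B : ℝ[X], B = (1 + X ^ 2) ^ (E.natDegree + 1) := ⟨_, rfl⟩
  have hB : ∀ t, 0 < B.eval t := fun t => by
    simp only [hBdef, eval_pow, eval_add, eval_one, eval_X]
    positivity
  have hBdeg : B.natDegree = 2 * (E.natDegree + 1) := by
    have : (1 + X ^ 2 : ℝ[X]).natDegree = 2 := by compute_degree!
    rw [hBdef, natDegree_pow, this, mul_comm]
  obtain ⟨d, hd, hN⟩ := exists_forall_eval_add_mul_sq_pos hYz hYlc hYev hEne hB
  obtain ⟨c, K, hc, hK, hKdeg⟩ : ∃ (c : ℝ) (K : ℝ[X]), c ≠ 0 ∧ C c * γ - F = U * K ∧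
      U.natDegree + K.natDegree ≤ γ.natDegree := by
    rcases hU with rfl | ⟨u, huz, rfl⟩
    · refine ⟨1, γ - F, one_ne_zero, by simp, ?_⟩
      rw [natDegree_one, zero_add]
      exact (natDegree_sub_le _ _).trans (by simp [hF])
    · have hroot : (C (F.eval u / γ.eval u) * γ - F).eval u = 0 := by
        simp [(hγ u).ne']
      obtain ⟨K, hK⟩ := dvd_iff_isRoot.2 hroot
      refine ⟨_, K, ?_, hK, ?_⟩
      · have := hP u
        have := sub_ne_zero.2 huz
        have := (hγ u).ne'
        simp [*]
      · have hle : (C (F.eval u / γ.eval u) * γ - F).natDegree ≤ γ.natDegree :=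
          (natDegree_sub_le _ _).trans (max_le (natDegree_C_mul_le _ _) hF)
        by_cases hK0 : K = 0
        · subst hK0
          have h1 : 0 < F.natDegree := by
            rw [hFdef, natDegree_mul (hXz _) hP0, natDegree_pow, natDegree_X_sub_C]
            omega
          simp
          omega
        · rwa [hK, natDegree_mul (X_sub_C_ne_zero u) hK0] at hle
  have hNdeg : (Y * B + C d * E ^ 2).natDegree = Y.natDegree + B.natDegree := by
    have hB0 : B ≠ 0 := by
      rintro rfl
      simpa using hB 0
    have hY0 : Y ≠ 0 := by
      rintro rfl
      simp at hYz
    rw [natDegree_add_eq_left_of_natDegree_lt, natDegree_mul hY0 hB0]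
    rw [natDegree_C_mul hd.ne', natDegree_pow, natDegree_mul hY0 hB0]
    omega
  have hNγ : (γ * (Y * B + C d * E ^ 2)).natDegree
      = γ.natDegree + (Y.natDegree + B.natDegree) := by
    rw [natDegree_mul _ _, hNdeg]
    · rintro rfl
      simpa using hγ 0
    · intro h0
      simpa [h0] using hN 0
  let w : DressD := ⟨_, div_mem_DressD (fun t => (hB t).ne')
    (P := -(C M * B + C d * U * E)) (by
      rw [natDegree_neg]
      refine natDegree_add_le_of_degree_le (natDegree_C_mul_le _ _) ?_
      refine natDegree_mul_le.trans ?_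
      have := natDegree_C_mul_le d U
      omega)⟩
  let s : DressD := ⟨_, div_mem_DressD (γ := γ * (Y * B + C d * E ^ 2))
    (fun t => by rw [eval_mul]; exact (mul_pos (hγ t) (hN t)).ne')
    (P := K * (E * B)) (by
      rw [hNγ]
      refine natDegree_mul_le.trans ?_
      have : (E * B).natDegree ≤ _ := natDegree_mul_le
      omega)⟩
  refine ⟨⟨_, algebraMap_C_mem_DressD c⟩, ⟨_, algebraMap_C_mem_DressD c⁻¹⟩, w, s, ?_, ?_⟩
  · ext1
    simp [hc]
  · ext1
    have nγ := algebraMap_ne_zero_of_eval_ne_zero (hγ 0).ne'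
    have nB := algebraMap_ne_zero_of_eval_ne_zero (hB 0).ne'
    have nN := algebraMap_ne_zero_of_eval_ne_zero (hN 0).ne'
    have nE := RatFunc.algebraMap_ne_zero hE0
    have e1 := congrArg (algebraMap ℝ[X] (RatFunc ℝ)) hGE
    have e2 := congrArg (algebraMap ℝ[X] (RatFunc ℝ)) hAM
    have e3 := congrArg (algebraMap ℝ[X] (RatFunc ℝ)) hK
    simp only [w, s, Subring.coe_mul, AddSubgroupClass.coe_sub, hf, hg]
    obtain ⟨N, hNdef⟩ : ∃ N, N = Y * B + C d * E ^ 2 := ⟨_, rfl⟩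
    have e4 := congrArg (algebraMap ℝ[X] (RatFunc ℝ)) hNdef
    rw [← hNdef] at nN ⊢
    simp only [map_mul, map_add, map_sub, map_neg, map_pow] at e1 e2 e3 e4 ⊢
    generalize algebraMap ℝ[X] (RatFunc ℝ) N = N at *
    field_simp
    rw [e3, e4]
    linear_combination (-algebraMap ℝ[X] (RatFunc ℝ) K) * (algebraMap ℝ[X] (RatFunc ℝ) B * e1 +
      algebraMap ℝ[X] (RatFunc ℝ) F * algebraMap ℝ[X] (RatFunc ℝ) B * e2)

theorem evalD_eq_zero_of_eval_eq_zero {p : DressD} {N γ : ℝ[X]} (hγ : ∀ t, 0 < γ.eval t)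
    (hp : (p : RatFunc ℝ) = algebraMap ℝ[X] (RatFunc ℝ) N / algebraMap ℝ[X] (RatFunc ℝ) γ)
    {u : ℝ} (hu : N.eval u = 0) : evalD p u = 0 := by
  have hγ0 : γ ≠ 0 := by
    rintro rfl
    simpa using hγ 0
  have h1 := congrArg (Polynomial.eval u) ((RatFunc.num_mul_eq_mul_denom_iff hγ0).2 hp)
  rw [eval_mul, eval_mul, hu, zero_mul] at h1
  have h2 : (RatFunc.num (p : RatFunc ℝ)).eval u = 0 :=
    (mul_eq_zero.1 h1).resolve_right (hγ u).ne'
  rw [evalD, RatFunc.eval, eval₂_id, h2, zero_div]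

theorem intDegree_div_of_ne_zero {N γ : ℝ[X]} (hN : N ≠ 0) (hγ : γ ≠ 0) :
    RatFunc.intDegree (algebraMap ℝ[X] (RatFunc ℝ) N / algebraMap ℝ[X] (RatFunc ℝ) γ)
      = N.natDegree - γ.natDegree := by
  rw [div_eq_mul_inv, RatFunc.intDegree_mul (RatFunc.algebraMap_ne_zero hN)
    (inv_ne_zero (RatFunc.algebraMap_ne_zero hγ)), RatFunc.intDegree_inv,
    RatFunc.intDegree_polynomial, RatFunc.intDegree_polynomial, sub_eq_add_neg]

theorem exists_mul_eq_of_unique_root {z : ℝ} {k h : ℕ} {P Q γ : ℝ[X]} (hk : 0 < k)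
    (hPz : P.eval z ≠ 0) (hγ : ∀ t, 0 < γ.eval t) {f g : DressD}
    (hf : (f : RatFunc ℝ) = algebraMap ℝ[X] (RatFunc ℝ) ((X - C z) ^ k * P) /
      algebraMap ℝ[X] (RatFunc ℝ) γ)
    (hg : (g : RatFunc ℝ) = algebraMap ℝ[X] (RatFunc ℝ) ((X - C z) ^ h * Q) /
      algebraMap ℝ[X] (RatFunc ℝ) γ)
    (hfdeg : RatFunc.intDegree (f : RatFunc ℝ) ≤ 0)
    (hodd : Odd (RatFunc.intDegree (f : RatFunc ℝ) + RatFunc.intDegree (g : RatFunc ℝ)))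
    (hroot : {u : ℝ | evalD f u = 0} = {z}) (hQ : 0 < Q.eval z * Q.leadingCoeff) :
    ∃ c c' w s : DressD, c * c' = 1 ∧ (c - f) * f = (g - f * w) * s := by
  have hP : ∀ t, P.eval t ≠ 0 := by
    intro t ht
    have : t ∈ {u : ℝ | evalD f u = 0} :=
      evalD_eq_zero_of_eval_eq_zero hγ hf (by rw [eval_mul, ht, mul_zero])
    rw [hroot, Set.mem_singleton_iff] at this
    exact hPz (this ▸ ht)
  have hP0 : P ≠ 0 := by
    rintro rfl
    simp at hPz
  have hQ0 : Q ≠ 0 := by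
    rintro rfl
    simp at hQ
  have hγ0 : γ ≠ 0 := by
    rintro rfl
    simpa using hγ 0
  have hXz : ∀ n : ℕ, (X - C z) ^ n ≠ 0 := fun n => pow_ne_zero n (X_sub_C_ne_zero z)
  have hfd := intDegree_div_of_ne_zero (mul_ne_zero (hXz k) hP0) hγ0
  have hgd := intDegree_div_of_ne_zero (mul_ne_zero (hXz h) hQ0) hγ0
  rw [← hf] at hfd
  rw [← hg] at hgd
  have hF : ((X - C z) ^ k * P).natDegree ≤ γ.natDegree := by omega
  have hFG : Odd (((X - C z) ^ k * P).natDegree + ((X - C z) ^ h * Q).natDegree) := by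
    rw [hfd, hgd] at hodd
    grind
  have hPQ : 0 < (P * Q).eval z * (P * Q).leadingCoeff := by
    rw [eval_mul, leadingCoeff_mul]
    have := mul_pos (eval_mul_leadingCoeff_pos hP z) hQ
    linarith
  rcases pos_and_pos_or_neg_and_neg_of_mul_pos hPQ with ⟨h1, h2⟩ | ⟨h1, h2⟩
  · exact exists_mul_eq_of_leadingCoeff_pos hk hP hγ h1 h2 hF hFG hf hg
  · obtain ⟨c, c', w, s, hc, hs⟩ := exists_mul_eq_of_leadingCoeff_pos (Q := -Q) (g := -g) (h := h)
      hk hP hγ (by simpa using h1) (by simpa using h2) hF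
      (by rwa [mul_neg, natDegree_neg]) hf (by simp [hg, neg_div])
    exact ⟨c, c', -w, -s, hc, by linear_combination hs⟩

theorem stmt_13 (z : ℝ) (k h : ℕ) (hk : 0 < k) (hh : 0 < h)
    (xbar ybar γ : Polynomial ℝ)
    (hxz : xbar.eval z ≠ 0) (hyz : ybar.eval z ≠ 0)
    (hγ : ∀ t : ℝ, 0 < γ.eval t)
    (p q : DressD)
    (hpval : (p : RatFunc ℝ) =
      algebraMap (Polynomial ℝ) (RatFunc ℝ) ((X - C z) ^ k * xbar) /
        algebraMap (Polynomial ℝ) (RatFunc ℝ) γ)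
    (hqval : (q : RatFunc ℝ) =
      algebraMap (Polynomial ℝ) (RatFunc ℝ) ((X - C z) ^ h * ybar) /
        algebraMap (Polynomial ℝ) (RatFunc ℝ) γ)
    (hpdeg : RatFunc.intDegree (p : RatFunc ℝ) < 0)
    (hqdeg : RatFunc.intDegree (q : RatFunc ℝ) < 0)
    (hpeven : Even (RatFunc.intDegree (p : RatFunc ℝ)))
    (hqodd : Odd (RatFunc.intDegree (q : RatFunc ℝ)))
    (hcase : ({u : ℝ | evalD p u = 0} = {z} ∧ 0 < ybar.eval z * ybar.leadingCoeff) ∨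
             ({u : ℝ | evalD q u = 0} = {z} ∧ 0 < xbar.eval z * xbar.leadingCoeff)) :
    IsProductOfIdempotents (!![p, q; 0, 0] : Matrix (Fin 2) (Fin 2) DressD) := by
  rcases hcase with ⟨hroot, hsign⟩ | ⟨hroot, hsign⟩
  · obtain ⟨c, c', w, s, hc, hs⟩ := exists_mul_eq_of_unique_root hk hxz hγ hpval hqval hpdeg.le
      (hpeven.add_odd hqodd) hroot hsign
    exact isProductOfIdempotents_of_mul_eq hc hs
  · obtain ⟨c, c', w, s, hc, hs⟩ := exists_mul_eq_of_unique_root hh hyz hγ hqval hpval hqdeg.le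
      (hqodd.add_even hpeven) hroot hsign
    exact isProductOfIdempotents_of_mul_eq_swap hc hs
end

section
/- Let p₀ = (X²−1)/(1+X²) and q₀ = X/(1+X²), which are elements of D, and let M = [[p₀, q₀], [0, 0]] ∈ M₂(D). Then there exist no p' ∈ D and no idempotent matrix T ∈ M₂(D) such that M = [[p', 0], [0, 0]]·T. -/
open Polynomial

/-- The rational function `(X² − 1)/(1 + X²)`. -/
noncomputable def pZero : RatFunc ℝ :=
  algebraMap (Polynomial ℝ) (RatFunc ℝ) (X ^ 2 - 1) /
    algebraMap (Polynomial ℝ) (RatFunc ℝ) (1 + X ^ 2)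

/-- The rational function `X/(1 + X²)`. -/
noncomputable def qZero : RatFunc ℝ :=
  algebraMap (Polynomial ℝ) (RatFunc ℝ) X /
    algebraMap (Polynomial ℝ) (RatFunc ℝ) (1 + X ^ 2)

/-- A rational function without real poles whose values on `ℝ` are bounded. -/
def IsBoundedRegular (z : RatFunc ℝ) : Prop :=
  (∀ x : ℝ, z.denom.eval x ≠ 0) ∧ ∃ C : ℝ, ∀ x : ℝ, |z.eval (RingHom.id ℝ) x| ≤ C

theorem eval_ne_zero_of_dvd {p q : ℝ[X]} (h : p ∣ q) {x : ℝ} (hq : q.eval x ≠ 0) :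
    p.eval x ≠ 0 := fun hp => hq (eval_eq_zero_of_dvd_of_eval_eq_zero h hp)

theorem eval_mul_eval_eq {z : RatFunc ℝ} {f g : ℝ[X]} (hg : g ≠ 0)
    (h : z = algebraMap ℝ[X] (RatFunc ℝ) f / algebraMap ℝ[X] (RatFunc ℝ) g) {x : ℝ}
    (hz : z.denom.eval x ≠ 0) : z.eval (RingHom.id ℝ) x * g.eval x = f.eval x := by
  have h' := congrArg (RatFunc.eval (RingHom.id ℝ) x)
    ((eq_div_iff (RatFunc.algebraMap_ne_zero hg)).1 h)
  rw [RatFunc.eval_mul _ _ (by simpa [eval₂_id] using hz)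
      (by rw [RatFunc.denom_algebraMap]; simp),
    RatFunc.eval_algebraMap, RatFunc.eval_algebraMap] at h'
  simpa only [Algebra.algebraMap_self, RingHom.id_apply, eval₂_id] using h'

namespace IsBoundedRegular

variable {z w : RatFunc ℝ}

theorem algebraMap_C (c : ℝ) : IsBoundedRegular (algebraMap ℝ[X] (RatFunc ℝ) (C c)) := by
  refine ⟨fun x => by simp, |c|, fun x => ?_⟩
  rw [RatFunc.eval_algebraMap]
  simp

theorem eval_add (hz : IsBoundedRegular z) (hw : IsBoundedRegular w) (x : ℝ) :
    (z + w).eval (RingHom.id ℝ) x = z.eval (RingHom.id ℝ) x + w.eval (RingHom.id ℝ) x :=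
  RatFunc.eval_add _ _ (by simpa [eval₂_id] using hz.1 x) (by simpa [eval₂_id] using hw.1 x)

theorem eval_mul (hz : IsBoundedRegular z) (hw : IsBoundedRegular w) (x : ℝ) :
    (z * w).eval (RingHom.id ℝ) x = z.eval (RingHom.id ℝ) x * w.eval (RingHom.id ℝ) x :=
  RatFunc.eval_mul _ _ (by simpa [eval₂_id] using hz.1 x) (by simpa [eval₂_id] using hw.1 x)

theorem add (hz : IsBoundedRegular z) (hw : IsBoundedRegular w) : IsBoundedRegular (z + w) := by
  obtain ⟨A, hA⟩ := hz.2
  obtain ⟨B, hB⟩ := hw.2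
  refine ⟨fun x => eval_ne_zero_of_dvd (RatFunc.denom_add_dvd z w) ?_, A + B, fun x => ?_⟩
  · rw [Polynomial.eval_mul]
    exact mul_ne_zero (hz.1 x) (hw.1 x)
  · rw [hz.eval_add hw]
    exact (abs_add_le _ _).trans (add_le_add (hA x) (hB x))

theorem mul (hz : IsBoundedRegular z) (hw : IsBoundedRegular w) : IsBoundedRegular (z * w) := by
  obtain ⟨A, hA⟩ := hz.2
  obtain ⟨B, hB⟩ := hw.2
  refine ⟨fun x => eval_ne_zero_of_dvd (RatFunc.denom_mul_dvd z w) ?_, A * B, fun x => ?_⟩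
  · rw [Polynomial.eval_mul]
    exact mul_ne_zero (hz.1 x) (hw.1 x)
  · rw [hz.eval_mul hw, abs_mul]
    exact mul_le_mul (hA x) (hB x) (abs_nonneg _) ((abs_nonneg _).trans (hA x))

theorem inv_one_add_sq (z : RatFunc ℝ) : IsBoundedRegular (1 + z ^ 2)⁻¹ := by
  have pos (x : ℝ) : 0 < (z.num ^ 2 + z.denom ^ 2).eval x := by
    obtain ⟨a, b, hab⟩ := z.isCoprime_num_denom
    have h := congrArg (Polynomial.eval x) hab
    simp only [Polynomial.eval_add, Polynomial.eval_mul, eval_one, eval_pow] at h ⊢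
    by_contra! hle
    have hn : z.num.eval x = 0 := by nlinarith [sq_nonneg (z.num.eval x), sq_nonneg (z.denom.eval x)]
    have hd : z.denom.eval x = 0 := by
      nlinarith [sq_nonneg (z.num.eval x), sq_nonneg (z.denom.eval x)]
    simp [hn, hd] at h
  have hne : z.num ^ 2 + z.denom ^ 2 ≠ 0 := fun h => by simpa [h] using pos 0
  have hd : algebraMap ℝ[X] (RatFunc ℝ) z.denom ≠ 0 :=
    RatFunc.algebraMap_ne_zero z.denom_ne_zero
  have hs : algebraMap ℝ[X] (RatFunc ℝ) (z.num ^ 2 + z.denom ^ 2) ≠ 0 :=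
    RatFunc.algebraMap_ne_zero hne
  have key : (1 + z ^ 2)⁻¹ = algebraMap ℝ[X] (RatFunc ℝ) (z.denom ^ 2) /
      algebraMap ℝ[X] (RatFunc ℝ) (z.num ^ 2 + z.denom ^ 2) := by
    conv_lhs => rw [← z.num_div_denom]
    rw [inv_eq_iff_eq_inv, inv_div, map_add, map_pow, map_pow]
    field_simp
    ring
  have hden (x : ℝ) : ((1 + z ^ 2)⁻¹ : RatFunc ℝ).denom.eval x ≠ 0 := by
    rw [key]
    exact eval_ne_zero_of_dvd (RatFunc.denom_div_dvd _ _) (pos x).ne'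
  refine ⟨hden, 1, fun x => ?_⟩
  have h := eval_mul_eval_eq hne key (hden x)
  rw [← eq_div_iff (pos x).ne'] at h
  rw [h, abs_of_nonneg (div_nonneg (by simpa using sq_nonneg _) (pos x).le), div_le_one (pos x)]
  simpa using sq_nonneg _

theorem continuous_eval (hz : IsBoundedRegular z) :
    Continuous fun x : ℝ => z.eval (RingHom.id ℝ) x := by
  simp only [RatFunc.eval, eval₂_id]
  exact z.num.continuous.div z.denom.continuous hz.1

theorem of_mem_DressD (hz : z ∈ DressD) : IsBoundedRegular z := by
  refine Subring.closure_induction ?_ ?_ ?_ ?_ ?_ ?_ hz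
  · rintro _ ⟨x, rfl⟩
    exact inv_one_add_sq x
  · simpa using algebraMap_C 0
  · simpa using algebraMap_C 1
  · exact fun _ _ _ _ => add
  · intro z _ hz
    simpa using (algebraMap_C (-1)).mul hz
  · exact fun _ _ _ _ => mul

end IsBoundedRegular

theorem one_add_X_sq_ne_zero : (1 + X ^ 2 : ℝ[X]) ≠ 0 := fun h => by
  simpa using congrArg (Polynomial.eval 0) h

/-- A common divisor `p` of `pZero` and `qZero` has no real zero, hence constant sign; the
relation coming from an idempotent would force opposite signs of `p` at `0` and near infinity. -/
theorem false_of_row_factorization {p a b c : RatFunc ℝ} (hp : IsBoundedRegular p)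
    (ha : IsBoundedRegular a) (hb : IsBoundedRegular b) (hc : IsBoundedRegular c)
    (hp₀ : IsBoundedRegular pZero) (hq₀ : IsBoundedRegular qZero)
    (hpa : pZero = p * a) (hpb : qZero = p * b) (hqc : qZero * c + pZero * a = pZero) : False := by
  have ep (x : ℝ) := eval_mul_eval_eq (z := pZero) one_add_X_sq_ne_zero rfl (hp₀.1 x)
  have eq (x : ℝ) := eval_mul_eval_eq (z := qZero) one_add_X_sq_ne_zero rfl (hq₀.1 x)
  have epa (x : ℝ) := congrArg (RatFunc.eval (RingHom.id ℝ) x) hpa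
  have epb (x : ℝ) := congrArg (RatFunc.eval (RingHom.id ℝ) x) hpb
  have eqc (x : ℝ) := congrArg (RatFunc.eval (RingHom.id ℝ) x) hqc
  simp only [hp.eval_mul ha, hp.eval_mul hb, (hq₀.mul hc).eval_add (hp₀.mul ha), hq₀.eval_mul hc,
    hp₀.eval_mul ha] at epa epb eqc
  simp only [eval_sub, Polynomial.eval_add, eval_pow, eval_X, eval_one] at ep eq
  obtain ⟨B, hB⟩ := hc.2
  have cont := hp.continuous_eval
  set P : ℝ → ℝ := fun x => p.eval (RingHom.id ℝ) x with hP
  have hne (x : ℝ) : P x ≠ 0 := by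
    intro h
    simp only [hP] at h
    have h1 := ep x
    have h2 := eq x
    rw [epa, h, zero_mul, zero_mul] at h1
    rw [epb, h, zero_mul, zero_mul] at h2
    rw [← h2] at h1
    norm_num at h1
  have h0 : P 0 < 0 := by
    have h1 := ep 0
    have h2 := eq 0
    have h3 := eqc 0
    have h4 := epa 0
    norm_num at h1 h2
    rw [h1, h2] at h3
    rw [h1] at h4
    have h5 : a.eval (RingHom.id ℝ) 0 = 1 := by linarith
    rw [h5] at h4
    simp only [hP]
    linarith
  have hneg (x : ℝ) : P x < 0 := by
    by_contra! h
    obtain ⟨y, hy⟩ := mem_range_of_exists_le_of_exists_ge cont ⟨0, h0.le⟩ ⟨x, h⟩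
    exact hne y hy
  have hB0 : 0 ≤ B := (abs_nonneg _).trans (hB 0)
  have h1 := ep (B + 2)
  have h2 := eq (B + 2)
  have h3 := eqc (B + 2)
  have h4 := epa (B + 2)
  have h5 := hneg (B + 2)
  have h6 := (abs_le.1 (hB (B + 2))).2
  simp only [hP] at h5
  generalize RatFunc.eval (RingHom.id ℝ) (B + 2) pZero = u at *
  generalize RatFunc.eval (RingHom.id ℝ) (B + 2) qZero = v at *
  generalize RatFunc.eval (RingHom.id ℝ) (B + 2) p = s at *
  generalize RatFunc.eval (RingHom.id ℝ) (B + 2) a = t at *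
  generalize RatFunc.eval (RingHom.id ℝ) (B + 2) c = r at *
  have hu : 0 < u := by
    have : 0 < u * (1 + (B + 2) ^ 2) := by rw [h1]; nlinarith
    exact pos_of_mul_pos_left this (by positivity)
  have ht : t < 0 := by
    by_contra! h
    nlinarith [mul_nonneg h (neg_pos.2 h5).le]
  have h7 : (B + 2) * r + ((B + 2) ^ 2 - 1) * t = (B + 2) ^ 2 - 1 := by
    linear_combination (1 + (B + 2) ^ 2) * h3 - r * h2 - t * h1 + h1
  have h8 : (B + 2) * r ≤ (B + 2) * B := mul_le_mul_of_nonneg_left h6 (by linarith)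
  have h9 : ((B + 2) ^ 2 - 1) * t ≤ 0 := mul_nonpos_of_nonneg_of_nonpos (by nlinarith) ht.le
  nlinarith

theorem stmt_14 (hp : pZero ∈ DressD) (hq : qZero ∈ DressD) :
    ¬∃ (p' : DressD) (T : Matrix (Fin 2) (Fin 2) DressD), IsIdempotentElem T ∧
      (!![(⟨pZero, hp⟩ : DressD), ⟨qZero, hq⟩; 0, 0] : Matrix (Fin 2) (Fin 2) DressD) =
        !![p', 0; 0, 0] * T := by
  rintro ⟨p', T, hT, hM⟩
  have hpa : pZero = p' * (T 0 0 : RatFunc ℝ) := by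
    simpa [Matrix.mul_apply] using congrArg (fun N => (N 0 0 : RatFunc ℝ)) hM
  have hpb : qZero = p' * (T 0 1 : RatFunc ℝ) := by
    simpa [Matrix.mul_apply] using congrArg (fun N => (N 0 1 : RatFunc ℝ)) hM
  have h00 : (T 0 0 * T 0 0 + T 0 1 * T 1 0 : RatFunc ℝ) = T 0 0 := by
    simpa [Matrix.mul_apply] using congrArg (fun N => (N 0 0 : RatFunc ℝ)) hT.eq
  refine false_of_row_factorization (.of_mem_DressD p'.2) (.of_mem_DressD (T 0 0).2)
    (.of_mem_DressD (T 0 1).2) (.of_mem_DressD (T 1 0).2) (.of_mem_DressD hp) (.of_mem_DressD hq)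
    hpa hpb ?_
  rw [hpa, hpb]
  linear_combination (p' : RatFunc ℝ) * h00
end

section
/- Let p₀ = (X²−1)/(1+X²) and q₀ = X/(1+X²), which are elements of D, and let M = [[p₀, q₀], [0, 0]] ∈ M₂(D). Then there exist no q' ∈ D and no idempotent matrix T ∈ M₂(D) such that M = [[0, q'], [0, 0]]·T. -/
open Polynomial

/-- Every element of `DressD` is a quotient of polynomials whose denominator has no real root. -/
theorem DressD.exists_polynomial_fraction {z : RatFunc ℝ} (hz : z ∈ DressD) :
    ∃ n d : ℝ[X], (∀ t, d.eval t ≠ 0) ∧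
      z * algebraMap ℝ[X] (RatFunc ℝ) d = algebraMap ℝ[X] (RatFunc ℝ) n := by
  unfold DressD at hz
  induction hz using Subring.closure_induction with
  | mem z hz =>
    obtain ⟨x, rfl⟩ := hz
    have hpos : ∀ t, (x.denom ^ 2 + x.num ^ 2).eval t ≠ 0 := by
      intro t ht
      simp only [eval_add, eval_pow] at ht
      have hd : x.denom.eval t = 0 := by
        nlinarith [sq_nonneg (x.denom.eval t), sq_nonneg (x.num.eval t)]
      have hn : x.num.eval t = 0 := by
        nlinarith [sq_nonneg (x.denom.eval t), sq_nonneg (x.num.eval t)]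
      obtain ⟨a, b, hab⟩ := x.isCoprime_num_denom
      have := congrArg (eval t) hab
      simp [hd, hn] at this
    have hd := RatFunc.algebraMap_ne_zero x.denom_ne_zero
    have hs : algebraMap ℝ[X] (RatFunc ℝ) (x.denom ^ 2 + x.num ^ 2) ≠ 0 := by
      refine RatFunc.algebraMap_ne_zero fun h => hpos 0 ?_
      rw [h, eval_zero]
    refine ⟨x.denom ^ 2, x.denom ^ 2 + x.num ^ 2, hpos, ?_⟩
    have key : (1 + x ^ 2) * algebraMap ℝ[X] (RatFunc ℝ) x.denom ^ 2 =
        algebraMap ℝ[X] (RatFunc ℝ) (x.denom ^ 2 + x.num ^ 2) := by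
      have h := (div_eq_iff hd).mp x.num_div_denom
      rw [map_add, map_pow, map_pow, h]
      ring
    have hx : 1 + x ^ 2 ≠ 0 := fun h => hs (by rw [← key, h, zero_mul])
    rw [← key, map_pow, inv_mul_cancel_left₀ hx]
  | zero => exact ⟨0, 1, by simp, by simp⟩
  | one => exact ⟨1, 1, by simp, by simp⟩
  | add x y _ _ hx hy =>
    obtain ⟨n, d, hd, h⟩ := hx
    obtain ⟨n', d', hd', h'⟩ := hy
    refine ⟨n * d' + n' * d, d * d', fun t => ?_, ?_⟩
    · rw [eval_mul]
      exact mul_ne_zero (hd t) (hd' t)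
    · simp only [map_add, map_mul, ← h, ← h']
      ring
  | neg x _ hx =>
    obtain ⟨n, d, hd, h⟩ := hx
    exact ⟨-n, d, hd, by rw [map_neg, ← h, neg_mul]⟩
  | mul x y _ _ hx hy =>
    obtain ⟨n, d, hd, h⟩ := hx
    obtain ⟨n', d', hd', h'⟩ := hy
    refine ⟨n * n', d * d', fun t => ?_, ?_⟩
    · rw [eval_mul]
      exact mul_ne_zero (hd t) (hd' t)
    · simp only [map_mul, ← h, ← h']
      ring

theorem algebraMap_one_add_X_sq_ne_zero :
    algebraMap ℝ[X] (RatFunc ℝ) (1 + X ^ 2) ≠ 0 := by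
  refine RatFunc.algebraMap_ne_zero fun h => ?_
  simpa using congrArg (eval 0) h

theorem pZero_sq_add_four_mul_qZero_sq : pZero ^ 2 + 4 * qZero ^ 2 = 1 := by
  have hs := algebraMap_one_add_X_sq_ne_zero
  unfold pZero qZero
  rw [div_pow, div_pow, ← mul_div_assoc, ← add_div, div_eq_one_iff_eq (pow_ne_zero 2 hs)]
  simp only [map_add, map_sub, map_pow, map_one]
  ring

/-- A unit `u` of `DressD` cannot satisfy `pZero * b + u * qZero ^ 2 = qZero` with `b` in `DressD`:
it would take the values `2` at `1` and `-2` at `-1`, and so vanish in between. -/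
theorem DressD.pZero_mul_add_mul_qZero_sq_ne {q u b : RatFunc ℝ} (hq : q ∈ DressD)
    (hu : u ∈ DressD) (hb : b ∈ DressD) (hqu : q * u = 1) :
    pZero * b + u * qZero ^ 2 ≠ qZero := by
  intro h
  obtain ⟨n₁, d₁, hd₁, h₁⟩ := exists_polynomial_fraction hq
  obtain ⟨n₂, d₂, hd₂, h₂⟩ := exists_polynomial_fraction hu
  obtain ⟨n₃, d₃, hd₃, h₃⟩ := exists_polynomial_fraction hb
  have hunit : n₁ * n₂ = d₁ * d₂ := by
    apply RatFunc.algebraMap_injective ℝ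
    rw [map_mul, map_mul, ← h₁, ← h₂]
    linear_combination
      (algebraMap ℝ[X] (RatFunc ℝ) d₁ * algebraMap ℝ[X] (RatFunc ℝ) d₂) * hqu
  have hrel : (X ^ 2 - 1) * (1 + X ^ 2) * n₃ * d₂ + X ^ 2 * n₂ * d₃ =
      X * (1 + X ^ 2) * d₂ * d₃ := by
    apply RatFunc.algebraMap_injective ℝ
    have hp := div_mul_cancel₀ (algebraMap ℝ[X] (RatFunc ℝ) (X ^ 2 - 1))
      algebraMap_one_add_X_sq_ne_zero
    have hr := div_mul_cancel₀ (algebraMap ℝ[X] (RatFunc ℝ) X)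
      algebraMap_one_add_X_sq_ne_zero
    rw [← pZero] at hp
    rw [← qZero] at hr
    simp only [map_add (algebraMap ℝ[X] (RatFunc ℝ)) (_ * _) (_ * _), map_mul,
      map_pow (algebraMap ℝ[X] (RatFunc ℝ)) X, ← hp, ← hr, ← h₂, ← h₃]
    linear_combination
      (algebraMap ℝ[X] (RatFunc ℝ) (1 + X ^ 2) ^ 2 * algebraMap ℝ[X] (RatFunc ℝ) d₂ *
        algebraMap ℝ[X] (RatFunc ℝ) d₃) * h
  have hne : ∀ t, (n₂ * d₂).eval t ≠ 0 := by
    intro t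
    have ht := congrArg (eval t) hunit
    rw [eval_mul, eval_mul] at ht
    rw [eval_mul]
    exact mul_ne_zero
      (right_ne_zero_of_mul (ht ▸ mul_ne_zero (hd₁ t) (hd₂ t))) (hd₂ t)
  have hone : n₂.eval 1 = 2 * d₂.eval 1 := by
    have ht := congrArg (eval 1) hrel
    norm_num at ht
    exact ht.resolve_right (hd₃ 1)
  have hneg : n₂.eval (-1) = -2 * d₂.eval (-1) := by
    have ht := congrArg (eval (-1)) hrel
    norm_num at ht
    exact mul_right_cancel₀ (hd₃ (-1)) (by linear_combination ht)
  have hzero : (0 : ℝ) ∈ (fun t => (n₂ * d₂).eval t) '' Set.Icc (-1) 1 := by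
    refine intermediate_value_Icc (by norm_num) (n₂ * d₂).continuous.continuousOn ⟨?_, ?_⟩
    · simp only [eval_mul, hneg]
      nlinarith [sq_nonneg (d₂.eval (-1))]
    · simp only [eval_mul, hone]
      nlinarith [sq_nonneg (d₂.eval 1)]
  obtain ⟨t, -, ht⟩ := hzero
  exact hne t ht

theorem stmt_15 (hp : pZero ∈ DressD) (hq : qZero ∈ DressD) :
    ¬∃ (q' : DressD) (T : Matrix (Fin 2) (Fin 2) DressD), IsIdempotentElem T ∧
      (!![(⟨pZero, hp⟩ : DressD), ⟨qZero, hq⟩; 0, 0] : Matrix (Fin 2) (Fin 2) DressD) =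
        !![0, q'; 0, 0] * T := by
  rintro ⟨q, T, hT, hM⟩
  have hpc : pZero = q * (T 1 0 : RatFunc ℝ) := by
    have h := congrArg Subtype.val (congrFun (congrFun hM 0) 0)
    simpa [Matrix.mul_apply, Fin.sum_univ_two] using h
  have hqd : qZero = q * (T 1 1 : RatFunc ℝ) := by
    have h := congrArg Subtype.val (congrFun (congrFun hM 0) 1)
    simpa [Matrix.mul_apply, Fin.sum_univ_two] using h
  have hid : (T 1 0 : RatFunc ℝ) * T 0 1 + T 1 1 * T 1 1 = T 1 1 := by
    have h := congrArg Subtype.val (congrFun (congrFun hT.eq 1) 1)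
    simpa [Matrix.mul_apply, Fin.sum_univ_two] using h
  let u : DressD := ⟨pZero, hp⟩ * T 1 0 + 4 * (⟨qZero, hq⟩ * T 1 1)
  have hu : (u : RatFunc ℝ) = pZero * T 1 0 + 4 * (qZero * T 1 1) := rfl
  have hqu : (q : RatFunc ℝ) * u = 1 := by
    rw [hu]
    linear_combination pZero_sq_add_four_mul_qZero_sq - pZero * hpc - 4 * qZero * hqd
  have hud : (u : RatFunc ℝ) * qZero = T 1 1 := by
    linear_combination u * hqd + T 1 1 * hqu
  refine DressD.pZero_mul_add_mul_qZero_sq_ne q.2 u.2 (T 0 1).2 hqu ?_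
  linear_combination T 0 1 * hpc + qZero * hud + (T 1 1 - 1) * hqd + q * hid
end

section
/- Let p₀ = (X²−1)/(1+X²) and q₀ = X/(1+X²), which are elements of D, and let M = [[p₀, q₀], [0, 0]] ∈ M₂(D). Then M is not the product of two idempotent matrices over D: there exist no idempotent matrices T₁, T₂ ∈ M₂(D) with M = T₁·T₂. -/
open Polynomial

/-- Every element of `DressD` is a quotient of polynomials whose denominator has no real root. -/
theorem exists_quotient_of_mem_DressD {z : RatFunc ℝ} (hz : z ∈ DressD) :
    ∃ f g : ℝ[X], (∀ x, g.eval x ≠ 0) ∧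
      z * algebraMap ℝ[X] (RatFunc ℝ) g = algebraMap ℝ[X] (RatFunc ℝ) f := by
  induction hz using Subring.closure_induction with
  | mem z hz =>
    obtain ⟨r, rfl⟩ := hz
    have hroot : ∀ x : ℝ, (r.num ^ 2 + r.denom ^ 2).eval x ≠ 0 := by
      intro x hx
      obtain ⟨u, v, huv⟩ := RatFunc.isCoprime_num_denom r
      have h := congrArg (Polynomial.eval x) huv
      simp only [eval_add, eval_mul, eval_pow, eval_one] at hx h
      have hn : r.num.eval x = 0 := by nlinarith [sq_nonneg (r.denom.eval x)]
      have hd : r.denom.eval x = 0 := by nlinarith [sq_nonneg (r.num.eval x)]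
      simp [hn, hd] at h
    refine ⟨r.denom ^ 2, r.num ^ 2 + r.denom ^ 2, hroot, ?_⟩
    have hden : algebraMap ℝ[X] (RatFunc ℝ) r.denom ≠ 0 :=
      RatFunc.algebraMap_ne_zero r.denom_ne_zero
    have hnum : algebraMap ℝ[X] (RatFunc ℝ) r.num = r * algebraMap ℝ[X] (RatFunc ℝ) r.denom :=
      (div_eq_iff hden).mp (RatFunc.num_div_denom r)
    have hne : algebraMap ℝ[X] (RatFunc ℝ) (r.num ^ 2 + r.denom ^ 2) ≠ 0 :=
      RatFunc.algebraMap_ne_zero fun h => hroot 0 (by simp [h])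
    have hfac : algebraMap ℝ[X] (RatFunc ℝ) (r.num ^ 2 + r.denom ^ 2) =
        (1 + r ^ 2) * algebraMap ℝ[X] (RatFunc ℝ) r.denom ^ 2 := by
      simp only [map_add, map_pow, hnum]
      ring
    have hunit : 1 + r ^ 2 ≠ 0 := fun h => hne (by rw [hfac, h, zero_mul])
    rw [hfac, inv_mul_cancel_left₀ hunit, map_pow]
  | zero => exact ⟨0, 1, by simp, by simp⟩
  | one => exact ⟨1, 1, by simp, by simp⟩
  | add y z _ _ hy hz =>
    obtain ⟨f, g, hg, h⟩ := hy
    obtain ⟨f', g', hg', h'⟩ := hz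
    refine ⟨f * g' + f' * g, g * g', fun x => by simp [hg x, hg' x], ?_⟩
    simp only [map_add, map_mul, ← h, ← h']
    ring
  | neg z _ hz =>
    obtain ⟨f, g, hg, h⟩ := hz
    exact ⟨-f, g, hg, by simp [← h]⟩
  | mul y z _ _ hy hz =>
    obtain ⟨f, g, hg, h⟩ := hy
    obtain ⟨f', g', hg', h'⟩ := hz
    refine ⟨f * f', g * g', fun x => by simp [hg x, hg' x], ?_⟩
    simp only [map_mul, ← h, ← h']
    ring

theorem pZero_mul : pZero * algebraMap ℝ[X] (RatFunc ℝ) (1 + X ^ 2) =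
    algebraMap ℝ[X] (RatFunc ℝ) (X ^ 2 - 1) :=
  div_mul_cancel₀ _ algebraMap_one_add_X_sq_ne_zero

theorem qZero_mul : qZero * algebraMap ℝ[X] (RatFunc ℝ) (1 + X ^ 2) =
    algebraMap ℝ[X] (RatFunc ℝ) X :=
  div_mul_cancel₀ _ algebraMap_one_add_X_sq_ne_zero

theorem pZero_ne_zero : pZero ≠ 0 := by
  refine div_ne_zero (RatFunc.algebraMap_ne_zero fun h => ?_) algebraMap_one_add_X_sq_ne_zero
  simpa using congrArg (Polynomial.eval 0) h

/-- If `v p + w q = 1` with `v` congruent to `1` modulo `w`, then `w` changes sign on `[-1, 1]`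
and hence vanishes at a point where `p < 1`, although `v = 1` there. -/
theorem not_exists_bezout_with_unit_relation {b v w : RatFunc ℝ} (hb : b ∈ DressD)
    (hv : v ∈ DressD) (hw : w ∈ DressD) (h : v + b * w = 1) (h' : v * pZero + w * qZero = 1) :
    False := by
  obtain ⟨fb, gb, hgb, eb⟩ := exists_quotient_of_mem_DressD hb
  obtain ⟨fv, gv, hgv, ev⟩ := exists_quotient_of_mem_DressD hv
  obtain ⟨fw, gw, hgw, ew⟩ := exists_quotient_of_mem_DressD hw
  have hpoly : fv * gb * gw + fb * fw * gv = gv * gb * gw := by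
    apply RatFunc.algebraMap_injective ℝ
    simp only [map_add, map_mul, ← eb, ← ev, ← ew]
    linear_combination (algebraMap ℝ[X] (RatFunc ℝ) gv * algebraMap ℝ[X] (RatFunc ℝ) gb *
      algebraMap ℝ[X] (RatFunc ℝ) gw) * h
  have hpoly' : fv * gw * (X ^ 2 - 1) + fw * gv * X = gv * gw * (1 + X ^ 2) := by
    apply RatFunc.algebraMap_injective ℝ
    rw [map_add, map_mul, map_mul, map_mul, map_mul, map_mul, map_mul, ← pZero_mul, ← qZero_mul,
      ← ev, ← ew]
    linear_combination (algebraMap ℝ[X] (RatFunc ℝ) gv * algebraMap ℝ[X] (RatFunc ℝ) gw *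
      algebraMap ℝ[X] (RatFunc ℝ) (1 + X ^ 2)) * h'
  have heval (x : ℝ) := congrArg (Polynomial.eval x) hpoly
  have heval' (x : ℝ) := congrArg (Polynomial.eval x) hpoly'
  simp only [eval_add, eval_mul, eval_sub, eval_pow, eval_X, eval_one] at heval heval'
  have hone : fw.eval 1 = 2 * gw.eval 1 :=
    mul_right_cancel₀ (hgv 1) (by linear_combination heval' 1)
  have hneg : fw.eval (-1) = -2 * gw.eval (-1) :=
    mul_right_cancel₀ (hgv (-1)) (by linear_combination -heval' (-1))
  have hmem : (0 : ℝ) ∈ Set.Icc ((fw * gw).eval (-1)) ((fw * gw).eval 1) := by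
    simp only [eval_mul, hone, hneg]
    constructor
    · nlinarith [sq_nonneg (gw.eval (-1))]
    · nlinarith [sq_nonneg (gw.eval 1)]
  obtain ⟨x, -, hx⟩ := intermediate_value_Icc (by norm_num : (-1 : ℝ) ≤ 1)
    (fw * gw).continuous.continuousOn hmem
  have hfw : fw.eval x = 0 := by simpa [hgw x] using hx
  have hfv : fv.eval x = gv.eval x :=
    mul_right_cancel₀ (mul_ne_zero (hgb x) (hgw x)) (by
      linear_combination heval x - fb.eval x * gv.eval x * hfw)
  have hlast := heval' x
  rw [hfv, hfw] at hlast
  have hcancel := mul_left_cancel₀ (mul_ne_zero (hgv x) (hgw x))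
    (show _ * (x ^ 2 - 1) = _ * (1 + x ^ 2) by linear_combination hlast)
  linarith

theorem stmt_16 (hp : pZero ∈ DressD) (hq : qZero ∈ DressD) :
    ¬∃ T₁ T₂ : Matrix (Fin 2) (Fin 2) DressD, IsIdempotentElem T₁ ∧ IsIdempotentElem T₂ ∧
      (!![(⟨pZero, hp⟩ : DressD), ⟨qZero, hq⟩; 0, 0] : Matrix (Fin 2) (Fin 2) DressD) =
        T₁ * T₂ := by
  rintro ⟨T₁, T₂, h₁, h₂, hM⟩
  set M : Matrix (Fin 2) (Fin 2) DressD := !![⟨pZero, hp⟩, ⟨qZero, hq⟩; 0, 0] with hMdef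
  have hleft : T₁ * M = M := by rw [hM, ← mul_assoc, h₁.eq]
  have hright : M * T₂ = M := by rw [hM, mul_assoc, h₂.eq]
  have entry {A B : Matrix (Fin 2) (Fin 2) DressD} (h : A = B) (i j : Fin 2) :
      (A i j : RatFunc ℝ) = B i j := by rw [h]
  have hT : (T₁ 0 0 : RatFunc ℝ) = 1 := by
    have := entry hleft 0 0
    simpa [hMdef, Matrix.mul_apply, Fin.sum_univ_two, pZero_ne_zero] using this
  have e₁ := entry hM 0 0
  have e₂ := entry hM 0 1
  have e₃ := entry hright 0 0
  have e₄ := entry hright 0 1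
  simp [hMdef, Matrix.mul_apply, Fin.sum_univ_two, hT] at e₁ e₂ e₃ e₄
  have hpq := pZero_sq_add_four_mul_qZero_sq
  let p : DressD := ⟨pZero, hp⟩
  let q : DressD := ⟨qZero, hq⟩
  refine not_exists_bezout_with_unit_relation (T₁ 0 1).2
    (p * T₂ 0 0 + 4 * q * T₂ 0 1).2 (p * T₂ 1 0 + 4 * q * T₂ 1 1).2 ?_ ?_
  · change pZero * (T₂ 0 0 : RatFunc ℝ) + 4 * qZero * T₂ 0 1 +
      T₁ 0 1 * (pZero * (T₂ 1 0 : RatFunc ℝ) + 4 * qZero * T₂ 1 1) = 1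
    linear_combination hpq - pZero * e₁ - 4 * qZero * e₂
  · change (pZero * (T₂ 0 0 : RatFunc ℝ) + 4 * qZero * T₂ 0 1) * pZero +
      (pZero * (T₂ 1 0 : RatFunc ℝ) + 4 * qZero * T₂ 1 1) * qZero = 1
    linear_combination hpq + pZero * e₃ + 4 * qZero * e₄
end
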